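/- arXiv:1709.08565 — 3 statements merged into one kernel-verified Lean document; each statement's English description precedes it below -/
import Mathlib

section
/- Let m ≥ 1, s ∈ (0,1), p ∈ [1,∞). There is a constant C > 0 (depending only on m, s, p) such that for every η ∈ (0,1), every open set A ⊆ ℝ^m, every ρ > 0 with B_ρ \ closure(B_{ηρ}) ⊆ A, and every measurable map u : A → N into a metric space N, one has E_{s,p}(u, A) ≤ (1 + C/(1−η)^{sp+1}) · E_{s,p}(u, A ∩ B_ρ) + (1 + C η^m/(1−η)) · E_{s,p}(u, A \ closure(B_{ηρ})), where B_r denotes the open ball of radius r centered at 0 and E_{s,p} is the Gagliardo energy with kernel d_N(u(x),u(y))^p/|x−y|^{m+sp}. -/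
open MeasureTheory ENNReal Metric

/-- The Gagliardo energy of a map `u` into a metric space `N` on a set `A ⊆ ℝ^m`. -/
noncomputable def gagliardoEnergy {m : ℕ} {N : Type} [PseudoMetricSpace N] (s p : ℝ)
    (u : EuclideanSpace ℝ (Fin m) → N) (A : Set (EuclideanSpace ℝ (Fin m))) : ℝ≥0∞ :=
  ∫⁻ x in A, ∫⁻ y in A,
    ENNReal.ofReal (dist (u x) (u y) ^ p / ‖x - y‖ ^ ((m : ℝ) + s * p))

/-- A closed set with uncountable image under a continuous map contains two small closed
subsets whose images are uncountable and disjoint. -/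
theorem IsClosed.exists_splitting_of_image_not_countable {α β : Type*} [MetricSpace α]
    [SecondCountableTopology α] [TopologicalSpace β] [T2Space β] {v : α → β} (hv : Continuous v)
    {A : Set α} (hA : IsClosed A) (hunc : ¬ (v '' A).Countable) {ε : ℝ≥0∞} (hε : 0 < ε) :
    ∃ A₀ A₁ : Set α,
      (IsClosed A₀ ∧ ¬ (v '' A₀).Countable ∧ A₀ ⊆ A ∧ ediam A₀ ≤ ε) ∧
      (IsClosed A₁ ∧ ¬ (v '' A₁).Countable ∧ A₁ ⊆ A ∧ ediam A₁ ≤ ε) ∧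
      Disjoint (v '' A₀) (v '' A₁) := by
  set S : Set α := {x | ∃ U ∈ nhds x, (v '' (A ∩ U)).Countable} with hS
  have hSc : (v '' (A ∩ S)).Countable := by
    have h1 : ∀ x, ∃ U ∈ nhds x, x ∈ S → (v '' (A ∩ U)).Countable := by
      intro x
      by_cases hx : x ∈ S
      · obtain ⟨U, hU, hc⟩ := hx
        exact ⟨U, hU, fun _ => hc⟩
      · exact ⟨Set.univ, Filter.univ_mem, fun h => absurd h hx⟩
    choose U hU hUc using h1
    obtain ⟨t, htS, htc, ht⟩ := TopologicalSpace.countable_cover_nhdsWithin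
      (s := S) (f := U) (fun x _ => mem_nhdsWithin_of_mem_nhds (hU x))
    refine (htc.biUnion fun x hx => hUc x (htS hx)).mono ?_
    rintro _ ⟨x, ⟨hxA, hxS⟩, rfl⟩
    obtain ⟨i, hi, hxi⟩ := Set.mem_iUnion₂.1 (ht hxS)
    exact Set.mem_biUnion hi ⟨x, ⟨hxA, hxi⟩, rfl⟩
  have hnon : (v '' (A \ S)).Nontrivial := by
    by_contra h
    apply hunc
    rw [← Set.inter_union_sdiff A S, Set.image_union]
    exact hSc.union (Set.not_nontrivial_iff.1 h).countable
  obtain ⟨_, ⟨a, ⟨haA, haS⟩, rfl⟩, _, ⟨b, ⟨hbA, hbS⟩, rfl⟩, hab⟩ := hnon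
  obtain ⟨V, W, hV, hW, haV, hbW, hVW⟩ := t2_separation hab
  have key : ∀ c ∈ A \ S, ∀ V : Set β, IsOpen V → v c ∈ V →
      ∃ A₀, (IsClosed A₀ ∧ ¬ (v '' A₀).Countable ∧ A₀ ⊆ A ∧ ediam A₀ ≤ ε) ∧ v '' A₀ ⊆ V := by
    rintro c ⟨hcA, hcS⟩ V hV hcV
    have hn : v ⁻¹' V ∈ nhds c := (hV.preimage hv).mem_nhds hcV
    obtain ⟨r, hr, hrV⟩ := nhds_basis_closedEBall.mem_iff.1 hn
    have hm : 0 < min r (ε / 2) := lt_min hr (ENNReal.half_pos hε.ne')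
    refine ⟨A ∩ closedEBall c (min r (ε / 2)),
      ⟨hA.inter isClosed_closedEBall, fun h => hcS ⟨_, ?_, h⟩, Set.inter_subset_left, ?_⟩, ?_⟩
    · exact closedEBall_mem_nhds c hm
    · refine (ediam_mono Set.inter_subset_right).trans (ediam_closedEBall_le.trans ?_)
      calc 2 * min r (ε / 2) ≤ 2 * (ε / 2) := by gcongr; exact min_le_right _ _
        _ = ε := ENNReal.mul_div_cancel (by simp) (by simp)
    · rintro _ ⟨x, ⟨_, hx⟩, rfl⟩
      exact hrV (closedEBall_subset_closedEBall (min_le_left _ _) hx)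
  obtain ⟨A₀, h₀, hV₀⟩ := key a ⟨haA, haS⟩ V hV haV
  obtain ⟨A₁, h₁, hW₁⟩ := key b ⟨hbA, hbS⟩ W hW hbW
  exact ⟨A₀, A₁, h₀, h₁, hVW.mono hV₀ hW₁⟩

open CantorScheme PiNat in
/-- A continuous map on a complete separable metric space with uncountable range is injective
on a copy of the Cantor space. -/
theorem Continuous.exists_nat_bool_comp_injective {α β : Type*} [MetricSpace α]
    [CompleteSpace α] [SecondCountableTopology α] [TopologicalSpace β] [T2Space β] {v : α → β}
    (hv : Continuous v) (hunc : ¬ (Set.range v).Countable) :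
    ∃ h : (ℕ → Bool) → α, Function.Injective (v ∘ h) := by
  obtain ⟨u, -, upos', hu⟩ := exists_seq_strictAnti_tendsto' (zero_lt_one' ℝ≥0∞)
  have upos := fun n => (upos' n).1
  let P := Subtype fun E : Set α => IsClosed E ∧ ¬ (v '' E).Countable
  choose C0 C1 h0 h1 hdisj using
    fun {C : Set α} (hC : IsClosed C) (hCu : ¬ (v '' C).Countable) {ε : ℝ≥0∞} (hε : 0 < ε) =>
    hC.exists_splitting_of_image_not_countable hv hCu hε
  let DP : List Bool → P := fun l => by
    induction l with
    | nil => exact ⟨Set.univ, isClosed_univ, by rwa [Set.image_univ]⟩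
    | cons a l ih =>
      cases a
      · use C0 ih.property.1 ih.property.2 (upos (l.length + 1))
        exact ⟨(h0 _ _ _).1, (h0 _ _ _).2.1⟩
      use C1 ih.property.1 ih.property.2 (upos (l.length + 1))
      exact ⟨(h1 _ _ _).1, (h1 _ _ _).2.1⟩
  let D : List Bool → Set α := fun l => (DP l).val
  have hanti : ClosureAntitone D := by
    refine Antitone.closureAntitone ?_ fun l => (DP l).property.1
    intro l a
    cases a
    · exact (h0 _ _ _).2.2.1
    exact (h1 _ _ _).2.2.1
  have hdiam : VanishingDiam D := by
    intro x
    apply tendsto_of_tendsto_of_tendsto_of_le_of_le' tendsto_const_nhds hu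
    · simp
    rw [Filter.eventually_atTop]
    refine ⟨1, fun m (hm : 1 ≤ m) => ?_⟩
    rw [Nat.one_le_iff_ne_zero] at hm
    rcases Nat.exists_eq_succ_of_ne_zero hm with ⟨n, rfl⟩
    dsimp
    cases x n
    · convert! (h0 _ _ _).2.2.2
      rw [PiNat.res_length]
    convert! (h1 _ _ _).2.2.2
    rw [PiNat.res_length]
  have hdisj' : CantorScheme.Disjoint fun l => v '' D l := by
    rintro l (a | a) (b | b) hab <;> try contradiction
    · exact hdisj _ _ _
    exact (hdisj _ _ _).symm
  have hne : ∀ l, (D l).Nonempty := fun l => by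
    by_contra h
    exact (DP l).property.2 (by
      have : (DP l).val = ∅ := Set.not_nonempty_iff_eq_empty.1 h
      simp [this])
  have hdom : ∀ {x : ℕ → Bool}, x ∈ (inducedMap D).1 := fun {x} => by
    rw [hanti.map_of_vanishingDiam hdiam hne]
    apply Set.mem_univ
  refine ⟨fun x => (inducedMap D).2 ⟨x, hdom⟩, fun x y hxy => ?_⟩
  have hmem : ∀ (x : ℕ → Bool) n, v ((inducedMap D).2 ⟨x, hdom⟩) ∈ v '' D (res x n) :=
    fun x n => Set.mem_image_of_mem v (map_mem ⟨x, hdom⟩ n)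
  apply res_injective
  ext n : 1
  induction n with
  | zero => simp
  | succ n ih =>
    simp only [res_succ, List.cons.injEq]
    refine ⟨?_, ih⟩
    by_contra hne'
    have hx := hmem x (n + 1)
    have hy := hmem y (n + 1)
    rw [res_succ] at hx
    rw [res_succ, ← ih] at hy
    rw [← show v ((inducedMap D).2 ⟨x, hdom⟩) = v ((inducedMap D).2 ⟨y, hdom⟩) from hxy] at hy
    exact Set.disjoint_left.1 (hdisj' (res x n) hne') hx hy

open Cardinal in
/-- A self-map of a Polish space pulling every set back to a Borel set has countable range. -/
theorem Set.countable_range_of_measurableSet_preimage {α : Type*} [TopologicalSpace α]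
    [PolishSpace α] [MeasurableSpace α] [BorelSpace α] {v : α → α}
    (hv : ∀ T : Set α, MeasurableSet (v ⁻¹' T)) : (Set.range v).Countable := by
  by_contra hunc
  have hvm : Measurable v := fun T _ => hv T
  have han : AnalyticSet (Set.range v) := by
    rw [← Set.image_univ]
    exact MeasurableSet.univ.analyticSet_image hvm
  rw [AnalyticSet] at han
  obtain han | ⟨f, hf, hfr⟩ := han
  · simp [han] at hunc
  let := TopologicalSpace.upgradeIsCompletelyMetrizable (ℕ → ℕ)
  obtain ⟨h, hh⟩ := hf.exists_nat_bool_comp_injective (by rwa [hfr])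
  have hinj : Function.Injective (fun T : Set (ℕ → Bool) =>
      (⟨v ⁻¹' ((f ∘ h) '' T), hv _⟩ : {t : Set α | MeasurableSet t})) := by
    intro T T' hTT
    have h2 : v ⁻¹' ((f ∘ h) '' T) = v ⁻¹' ((f ∘ h) '' T') := congrArg Subtype.val hTT
    have h3 : ∀ T : Set (ℕ → Bool), (f ∘ h) '' T ⊆ Set.range v := by
      rintro T _ ⟨x, _, rfl⟩
      rw [← hfr]
      exact ⟨h x, rfl⟩
    rw [Set.preimage_eq_preimage' (h3 T) (h3 T')] at h2
    exact hh.image_injective h2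
  have hle := Cardinal.lift_mk_le_lift_mk_of_injective hinj
  have hb : #{t : Set α | MeasurableSet t} ≤ 𝔠 := by
    obtain ⟨b, hbc, -, hb⟩ := TopologicalSpace.exists_countable_basis α
    have hgen := (BorelSpace.measurable_eq (α := α)).trans hb.borel_eq_generateFrom
    rw [hgen]
    exact MeasurableSpace.cardinal_measurableSet_le_continuum
      ((Cardinal.mk_le_aleph0_iff.2 hbc.to_subtype).trans aleph0_le_continuum)
  have h4 : lift.{0} #{t : Set α | MeasurableSet t} ≤ 𝔠 := by simpa using hb
  have h5 := hle.trans h4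
  simp at h5
  exact absurd h5 (not_le.2 (Cardinal.cantor _))

/-- A Borel map from a Polish space to a metric space is strongly measurable. -/
theorem stronglyMeasurable_of_measurable_polishSpace {α N : Type*} [TopologicalSpace α]
    [PolishSpace α] [MeasurableSpace α] [BorelSpace α] [MetricSpace N] [MeasurableSpace N]
    [BorelSpace N] {u : α → N} (hu : Measurable u) : StronglyMeasurable u := by
  rw [stronglyMeasurable_iff_measurable_separable]
  refine ⟨hu, ?_⟩
  cases isEmpty_or_nonempty α
  · exact (Set.countable_range u).isSeparable
  by_contra hsep
  have hex : ∃ ε > 0, ∀ t : Set N, t.Countable →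
      ¬ Set.range u ⊆ ⋃ x ∈ t, closedEBall x ε := by
    by_contra! h
    obtain ⟨t, -, htc, ht⟩ := EMetric.subset_countable_closure_of_almost_dense_set (Set.range u) h
    exact hsep ⟨t, htc, ht⟩
  obtain ⟨ε, hε, hcov⟩ := hex
  obtain ⟨D, hD⟩ := zorn_subset {D : Set N | D ⊆ Set.range u ∧ D.Pairwise fun x y => ε < edist x y}
    (by
      intro c hc hchain
      refine ⟨⋃₀ c, ⟨Set.sUnion_subset fun s hs => (hc hs).1, ?_⟩,
        fun s hs => Set.subset_sUnion_of_mem hs⟩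
      exact (Set.pairwise_sUnion hchain.directedOn).2 fun s hs => (hc hs).2)
  have hDsub := hD.prop.1
  have hDsep := hD.prop.2
  have hDunc : ¬ D.Countable := by
    intro hDc
    refine hcov D hDc ?_
    intro x hx
    by_contra hxc
    simp only [Set.mem_iUnion, mem_closedEBall, not_exists, not_le] at hxc
    have hins : insert x D ∈ {D : Set N | D ⊆ Set.range u ∧ D.Pairwise fun x y => ε < edist x y} :=
      ⟨Set.insert_subset hx hDsub, hDsep.insert fun y hy _ =>
        ⟨hxc y hy, by rw [edist_comm]; exact hxc y hy⟩⟩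
    have hxD : x ∈ D := hD.le_of_ge hins (Set.subset_insert x D) (Set.mem_insert x D)
    simpa using hxc x hxD
  have hclosed : ∀ T ⊆ D, IsClosed T := by
    intro T hT
    refine isClosed_of_spaced_out (edist_mem_uniformity hε) fun x hx y hy hxy => ?_
    exact not_lt.2 (hDsep (hT hx) (hT hy) hxy).le
  have hmeas : ∀ T ⊆ D, MeasurableSet (u ⁻¹' T) := fun T hT => hu (hclosed T hT).measurableSet
  choose g hg using hDsub
  classical
  obtain ⟨x₀⟩ := ‹Nonempty α›
  let v : α → α := fun x => if h : u x ∈ D then g h else x₀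
  have hv : ∀ T : Set α, MeasurableSet (v ⁻¹' T) := by
    intro T
    have : v ⁻¹' T = u ⁻¹' {y | ∃ h : y ∈ D, g h ∈ T} ∪ ((u ⁻¹' D)ᶜ ∩ {_x | x₀ ∈ T}) := by
      ext x
      by_cases h : u x ∈ D <;> simp [v, h]
    rw [this]
    exact (hmeas _ fun y hy => hy.1).union ((hmeas D le_rfl).compl.inter (MeasurableSet.const _))
  have hc := Set.countable_range_of_measurableSet_preimage hv
  apply hDunc
  refine (hc.image u).mono fun y hy => ?_
  obtain ⟨x, rfl⟩ := hD.prop.1 hy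
  exact ⟨v x, ⟨x, rfl⟩, by simp only [v, hy, dif_pos, hg]⟩

open scoped Pointwise in
/-- The part of a cone in a spherical shell carries a definite fraction of the measure of its part
in the whole ball. -/
theorem volume_cone_inter_shell_ge {m : ℕ} (hm : 1 ≤ m) {S : Set (EuclideanSpace ℝ (Fin m))}
    (hS : ∀ c : ℝ, 0 < c → ∀ z ∈ S, c • z ∈ S) {η ρ : ℝ} (hη : η ∈ Set.Ioo (0 : ℝ) 1)
    (hρ : 0 < ρ) :
    ENNReal.ofReal (1 - η) * volume (S ∩ ball 0 ρ)
      ≤ volume (S ∩ (ball 0 ρ \ closedBall 0 (η * ρ))) := by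
  obtain ⟨hη0, hη1⟩ := hη
  set V := volume (S ∩ ball 0 ρ) with hV
  have hVfin : V ≠ ∞ := ((measure_mono Set.inter_subset_right).trans_lt measure_ball_lt_top).ne
  have hclosed : volume (S ∩ closedBall 0 ρ) ≤ V := by
    rw [← ball_union_sphere, Set.inter_union_distrib_left]
    refine (measure_union_le _ _).trans ?_
    rw [measure_mono_null Set.inter_subset_right (Measure.addHaar_sphere_of_ne_zero _ _ hρ.ne'),
      add_zero]
  have hinner : volume (S ∩ closedBall 0 (η * ρ)) ≤ ENNReal.ofReal (η ^ m) * V := by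
    have hsub : S ∩ closedBall 0 (η * ρ) ⊆ η • (S ∩ closedBall 0 ρ) := by
      rintro z ⟨hz, hzb⟩
      refine ⟨η⁻¹ • z, ⟨hS _ (inv_pos.2 hη0) z hz, ?_⟩, smul_inv_smul₀ hη0.ne' z⟩
      rw [mem_closedBall_zero_iff] at hzb ⊢
      rw [norm_smul, norm_inv, Real.norm_of_nonneg hη0.le, inv_mul_le_iff₀ hη0]
      exact hzb
    refine (measure_mono hsub).trans ?_
    rw [Measure.addHaar_smul, finrank_euclideanSpace_fin, abs_of_nonneg (by positivity)]
    gcongr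
  have hsplit : V ≤ volume (S ∩ (ball 0 ρ \ closedBall 0 (η * ρ)))
      + ENNReal.ofReal (η ^ m) * V := by
    refine le_trans ?_ (add_le_add_right hinner _)
    refine (measure_mono ?_).trans (measure_union_le _ _)
    rintro z ⟨hz, hzb⟩
    by_cases h : z ∈ closedBall 0 (η * ρ)
    · exact Or.inr ⟨hz, h⟩
    · exact Or.inl ⟨hz, hzb, h⟩
  have hpow : η ^ m ≤ η := by
    simpa using pow_le_pow_of_le_one hη0.le hη1.le hm
  have hfin : ENNReal.ofReal (η ^ m) * V ≠ ∞ := mul_ne_top ofReal_ne_top hVfin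
  refine (ENNReal.add_le_add_iff_right hfin).1 (le_trans ?_ hsplit)
  rw [← add_mul, ← ENNReal.ofReal_add (by linarith) (by positivity)]
  calc ENNReal.ofReal (1 - η + η ^ m) * V ≤ ENNReal.ofReal 1 * V := by gcongr; linarith
    _ = V := by simp

/-- The points `z` of the shell `B_ρ \ B_r` whose direction is within `1 - ‖x‖ / ρ` of the
direction of `x`. -/
def shellCone {m : ℕ} (r ρ : ℝ) (x : EuclideanSpace ℝ (Fin m)) :
    Set (EuclideanSpace ℝ (Fin m)) :=
  {z | ‖‖x‖⁻¹ • x - ‖z‖⁻¹ • z‖ < 1 - ‖x‖ / ρ} ∩ (ball 0 ρ \ closedBall 0 r)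

/-- The density in `z` of the uniform probability measure on `shellCone r ρ x`. -/
noncomputable def shellConeKernel {m : ℕ} (r ρ : ℝ) (x z : EuclideanSpace ℝ (Fin m)) : ℝ≥0∞ :=
  (shellCone r ρ x).indicator (fun _ => (volume (shellCone r ρ x))⁻¹) z

section shellCone

variable {m : ℕ} {r ρ η : ℝ} {x y z : EuclideanSpace ℝ (Fin m)}

theorem norm_lt_of_mem_shellCone (hz : z ∈ shellCone r ρ x) (hx : ‖x‖ ≤ r) :
    ‖x‖ < ‖z‖ ∧ ‖z‖ < ρ := by
  obtain ⟨-, hzρ, hzr⟩ := hz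
  rw [mem_ball_zero_iff] at hzρ
  rw [mem_closedBall_zero_iff, not_le] at hzr
  exact ⟨hx.trans_lt hzr, hzρ⟩

theorem norm_sub_le_of_mem_shellCone (hz : z ∈ shellCone r ρ x) (hx : ‖x‖ ≤ r) :
    ‖x - z‖ ≤ 2 * (ρ - ‖x‖) := by
  obtain ⟨h1, h2⟩ := norm_lt_of_mem_shellCone hz hx
  have hz0 : 0 < ‖z‖ := (norm_nonneg x).trans_lt h1
  have hρ : 0 < ρ := hz0.trans h2
  have hdir : ‖‖x‖⁻¹ • x - ‖z‖⁻¹ • z‖ < 1 - ‖x‖ / ρ := hz.1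
  have hx1 : ‖‖x‖⁻¹ • x‖ ≤ 1 := by
    rw [norm_smul, norm_inv, norm_norm]
    exact inv_mul_le_one
  have hdec : x - z = ‖z‖ • (‖x‖⁻¹ • x - ‖z‖⁻¹ • z) - (‖z‖ - ‖x‖) • (‖x‖⁻¹ • x) := by
    rcases eq_or_ne x 0 with rfl | hx0
    · simp [smul_smul, hz0.ne']
    · have : ‖x‖ ≠ 0 := norm_ne_zero_iff.2 hx0
      rw [smul_sub, sub_smul, smul_smul ‖z‖ ‖z‖⁻¹, mul_inv_cancel₀ hz0.ne', smul_smul ‖x‖ ‖x‖⁻¹,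
        mul_inv_cancel₀ this]
      simp only [one_smul]
      abel
  rw [hdec]
  refine (norm_sub_le _ _).trans ?_
  rw [norm_smul, norm_smul, norm_norm, Real.norm_of_nonneg (by linarith)]
  have e1 : ‖z‖ * ‖‖x‖⁻¹ • x - ‖z‖⁻¹ • z‖ ≤ ρ * (1 - ‖x‖ / ρ) := by gcongr
  have e2 : (‖z‖ - ‖x‖) * ‖‖x‖⁻¹ • x‖ ≤ (ρ - ‖x‖) * 1 := by gcongr; linarith
  rw [mul_sub, mul_div_cancel₀ _ hρ.ne'] at e1
  linarith

theorem sub_norm_le_norm_sub (hy : ρ ≤ ‖y‖) : ρ - ‖x‖ ≤ ‖x - y‖ := by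
  have := norm_sub_norm_le y x
  rw [norm_sub_rev] at this
  linarith

theorem norm_sub_le_three_mul (hz : z ∈ shellCone r ρ x) (hx : ‖x‖ ≤ r) (hy : ρ ≤ ‖y‖) :
    ‖z - y‖ ≤ 3 * ‖x - y‖ := by
  have h1 := norm_sub_le_of_mem_shellCone hz hx
  have h2 := sub_norm_le_norm_sub (x := x) hy
  have h3 := norm_sub_le_norm_sub_add_norm_sub z x y
  rw [norm_sub_rev z x] at h3
  linarith

theorem measurableSet_shellCone_prod :
    MeasurableSet {q : EuclideanSpace ℝ (Fin m) × EuclideanSpace ℝ (Fin m) |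
      q.2 ∈ shellCone r ρ q.1} := by
  refine MeasurableSet.inter (measurableSet_lt (by fun_prop) (by fun_prop)) ?_
  exact measurable_snd (measurableSet_ball.diff measurableSet_closedBall)

theorem measurableSet_shellCone : MeasurableSet (shellCone r ρ x) :=
  measurable_prodMk_left (x := x) (measurableSet_shellCone_prod (r := r) (ρ := ρ))

theorem measurable_volume_shellCone :
    Measurable fun x : EuclideanSpace ℝ (Fin m) => volume (shellCone r ρ x) :=
  measurable_measure_prodMk_left (measurableSet_shellCone_prod (r := r) (ρ := ρ))

theorem measurable_shellConeKernel :
    Measurable fun q : EuclideanSpace ℝ (Fin m) × EuclideanSpace ℝ (Fin m) =>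
      shellConeKernel r ρ q.1 q.2 :=
  Measurable.indicator (f := fun q : EuclideanSpace ℝ (Fin m) × EuclideanSpace ℝ (Fin m) =>
    (volume (shellCone r ρ q.1))⁻¹) (measurable_volume_shellCone.comp measurable_fst).inv
    measurableSet_shellCone_prod

theorem lintegral_shellConeKernel :
    ∫⁻ z, shellConeKernel r ρ x z = (volume (shellCone r ρ x))⁻¹ * volume (shellCone r ρ x) := by
  simp only [shellConeKernel]
  rw [lintegral_indicator_const measurableSet_shellCone]

theorem volume_shellCone_lt_top : volume (shellCone r ρ x) < ∞ :=
  (measure_mono (Set.inter_subset_right.trans Set.sdiff_subset)).trans_lt measure_ball_lt_top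

theorem volume_shellCone_ge (hm : 1 ≤ m) (hη : η ∈ Set.Ioo (0 : ℝ) 1) (hρ : 0 < ρ)
    (hx0 : x ≠ 0) (hx : ‖x‖ ≤ η * ρ) :
    ENNReal.ofReal ((1 - η) * ((ρ - ‖x‖) / 8) ^ m) *
      volume (ball (0 : EuclideanSpace ℝ (Fin m)) 1) ≤ volume (shellCone (η * ρ) ρ x) := by
  have hxρ : ‖x‖ < ρ := hx.trans_lt (by nlinarith [hη.2])
  have hn : 0 < ‖x‖ := norm_pos_iff.2 hx0
  refine le_trans ?_ (volume_cone_inter_shell_ge hm ?_ hη hρ)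
  · rw [ENNReal.ofReal_mul (by linarith [hη.2]), mul_assoc]
    gcongr
    have hb := Measure.addHaar_ball_of_pos volume ((ρ / 2) • (‖x‖⁻¹ • x))
      (show 0 < (ρ - ‖x‖) / 8 by linarith)
    rw [finrank_euclideanSpace_fin] at hb
    rw [← hb]
    refine measure_mono fun z hz => ?_
    rw [mem_ball_iff_norm] at hz
    have he1 : ‖‖x‖⁻¹ • x‖ = 1 := by rw [norm_smul, norm_inv, norm_norm, inv_mul_cancel₀ hn.ne']
    set e := ‖x‖⁻¹ • x with he
    clear_value e
    have hec : ‖(ρ / 2) • e‖ = ρ / 2 := by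
      rw [norm_smul, he1, Real.norm_of_nonneg (by positivity), mul_one]
    have h1 : |‖z‖ - ρ / 2| ≤ ‖z - (ρ / 2) • e‖ := by
      have := abs_norm_sub_norm_le z ((ρ / 2) • e)
      rwa [hec] at this
    have h2 := abs_le.1 (h1.trans hz.le)
    have hz0 : 0 < ‖z‖ := by linarith
    refine ⟨?_, by rw [mem_ball_zero_iff]; linarith⟩
    change ‖e - ‖z‖⁻¹ • z‖ < 1 - ‖x‖ / ρ
    have hdec : e - ‖z‖⁻¹ • z = (2 / ρ) • ((ρ / 2) • e - z) +
        ((2 / ρ) * (‖z‖ - ρ / 2)) • (‖z‖⁻¹ • z) := by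
      match_scalars <;> field_simp
      ring
    have hz1 : ‖‖z‖⁻¹ • z‖ = 1 := by rw [norm_smul, norm_inv, norm_norm, inv_mul_cancel₀ hz0.ne']
    rw [hdec]
    refine (norm_add_le _ _).trans_lt ?_
    rw [norm_smul, norm_smul, hz1, norm_sub_rev, norm_mul, Real.norm_of_nonneg (by positivity),
      Real.norm_eq_abs, mul_one]
    calc 2 / ρ * ‖z - (ρ / 2) • e‖ + 2 / ρ * |‖z‖ - ρ / 2|
        ≤ 2 / ρ * ((ρ - ‖x‖) / 8) + 2 / ρ * ((ρ - ‖x‖) / 8) := by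
          gcongr
          exact h1.trans hz.le
      _ = (1 - ‖x‖ / ρ) / 2 := by field_simp; ring
      _ < 1 - ‖x‖ / ρ := by
          have : ‖x‖ / ρ < 1 := (div_lt_one hρ).2 hxρ
          linarith
  · intro c hc z hz
    have : ‖c • z‖⁻¹ • c • z = ‖z‖⁻¹ • z := by
      rw [norm_smul, Real.norm_of_nonneg hc.le, smul_smul, mul_inv, mul_right_comm,
        inv_mul_cancel₀ hc.ne', one_mul]
    simpa only [Set.mem_ofPred_eq, this] using hz

theorem mem_shellCone_map_iff (L : EuclideanSpace ℝ (Fin m) ≃ₗᵢ[ℝ] EuclideanSpace ℝ (Fin m)) :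
    L z ∈ shellCone r ρ (L x) ↔ z ∈ shellCone r ρ x := by
  simp only [shellCone, Set.mem_inter_iff, Set.mem_ofPred_eq, LinearIsometryEquiv.norm_map,
    Set.mem_sdiff, mem_ball_zero_iff, mem_closedBall_zero_iff, ← map_smul, ← map_sub]

theorem volume_shellCone_map (L : EuclideanSpace ℝ (Fin m) ≃ₗᵢ[ℝ] EuclideanSpace ℝ (Fin m)) :
    volume (shellCone r ρ (L x)) = volume (shellCone r ρ x) := by
  have hpre : L ⁻¹' shellCone r ρ (L x) = shellCone r ρ x :=
    Set.ext fun z => (Set.mem_preimage (f := L)).trans (mem_shellCone_map_iff L)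
  have hL : MeasurePreserving L volume volume := L.measurePreserving
  have hms : NullMeasurableSet (shellCone r ρ (L x)) volume :=
    measurableSet_shellCone.nullMeasurableSet
  rw [← hL.measure_preimage hms, hpre]

/-- By rotation invariance, the second marginal of the kernel is constant on the shell. -/
theorem lintegral_shellConeKernel_left_eq (hr : 0 ≤ r)
    (hz : z ∈ ball 0 ρ \ closedBall 0 r) (hy : y ∈ ball 0 ρ \ closedBall 0 r) :
    ∫⁻ x in closedBall 0 r, shellConeKernel r ρ x z
      = ∫⁻ x in closedBall 0 r, shellConeKernel r ρ x y := by
  have hpos : ∀ w : EuclideanSpace ℝ (Fin m), w ∈ ball 0 ρ \ closedBall 0 r → 0 < ‖w‖ := by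
    intro w hw
    have := hw.2
    rw [mem_closedBall_zero_iff, not_le] at this
    linarith
  have hunit : ∀ w : EuclideanSpace ℝ (Fin m), 0 < ‖w‖ → ‖‖w‖⁻¹ • w‖ = 1 := by
    intro w hw
    rw [norm_smul, norm_inv, norm_norm, inv_mul_cancel₀ hw.ne']
  have hnorm : ‖‖z‖⁻¹ • z‖ = ‖‖y‖⁻¹ • y‖ := by rw [hunit z (hpos z hz), hunit y (hpos y hy)]
  set L := (ℝ ∙ (‖z‖⁻¹ • z - ‖y‖⁻¹ • y))ᗮ.reflection with hL
  have hLzy : L (‖z‖⁻¹ • z) = ‖y‖⁻¹ • y := Submodule.reflection_sub hnorm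
  have hmem : ∀ x, L z ∈ shellCone r ρ x ↔ y ∈ shellCone r ρ x := by
    intro x
    have hLz : L z ∈ ball 0 ρ \ closedBall 0 r := by simpa using hz
    simp only [shellCone, Set.mem_inter_iff, Set.mem_ofPred_eq, hLz, hy,
      LinearIsometryEquiv.norm_map, ← hLzy, map_smul]
  rw [← lintegral_indicator measurableSet_closedBall,
    ← lintegral_indicator measurableSet_closedBall,
    ← L.measurePreserving.lintegral_comp (f := (closedBall 0 r).indicator
      fun x => shellConeKernel r ρ x y)]
  · refine lintegral_congr fun x => ?_
    by_cases hx : x ∈ closedBall 0 r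
    · have hLx : L x ∈ closedBall 0 r := by simpa using hx
      rw [Set.indicator_of_mem hx, Set.indicator_of_mem hLx]
      by_cases h : z ∈ shellCone r ρ x
      · have h' : y ∈ shellCone r ρ (L x) := (hmem _).1 ((mem_shellCone_map_iff L).2 h)
        simp only [shellConeKernel]
        rw [Set.indicator_of_mem h, Set.indicator_of_mem h', volume_shellCone_map]
      · have h' : y ∉ shellCone r ρ (L x) :=
          fun h' => h ((mem_shellCone_map_iff L).1 ((hmem _).2 h'))
        simp only [shellConeKernel]
        rw [Set.indicator_of_notMem h, Set.indicator_of_notMem h']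
    · have hLx : L x ∉ closedBall 0 r := by simpa using hx
      rw [Set.indicator_of_notMem hx, Set.indicator_of_notMem hLx]
  · exact (measurable_shellConeKernel.comp measurable_prodMk_right).indicator
      measurableSet_closedBall

theorem lintegral_shellConeKernel_left_le (hm : 1 ≤ m) (hη : η ∈ Set.Ioo (0 : ℝ) 1) (hρ : 0 < ρ)
    (hz : z ∈ ball 0 ρ \ closedBall 0 (η * ρ)) :
    ∫⁻ x in closedBall 0 (η * ρ), shellConeKernel (η * ρ) ρ x z
      ≤ ENNReal.ofReal (η ^ m / (1 - η)) := by
  obtain ⟨hη0, hη1⟩ := id hη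
  set R : Set (EuclideanSpace ℝ (Fin m)) := ball 0 ρ \ closedBall 0 (η * ρ) with hR
  set F := ∫⁻ x in closedBall 0 (η * ρ), shellConeKernel (η * ρ) ρ x z with hF
  set V := volume (ball (0 : EuclideanSpace ℝ (Fin m)) ρ) with hV
  have hRm : MeasurableSet R := measurableSet_ball.diff measurableSet_closedBall
  have hVol : ENNReal.ofReal (1 - η) * V ≤ volume R := by
    simpa using volume_cone_inter_shell_ge (S := Set.univ) hm (by simp) hη hρ
  have hInn : volume (closedBall (0 : EuclideanSpace ℝ (Fin m)) (η * ρ))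
      = ENNReal.ofReal (η ^ m) * V := by
    rw [hV, Measure.addHaar_ball_of_pos _ _ hρ, Measure.addHaar_closedBall _ _ (by positivity),
      mul_pow, ENNReal.ofReal_mul (by positivity), finrank_euclideanSpace_fin, mul_assoc]
  have hFR : F * volume R ≤ ENNReal.ofReal (η ^ m) * V := by
    calc F * volume R = ∫⁻ _w in R, F := by rw [setLIntegral_const]
      _ = ∫⁻ w in R, ∫⁻ x in closedBall 0 (η * ρ), shellConeKernel (η * ρ) ρ x w :=
          setLIntegral_congr_fun hRm fun w hw =>
            lintegral_shellConeKernel_left_eq (by positivity) hz hw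
      _ = ∫⁻ x in closedBall 0 (η * ρ), ∫⁻ w in R, shellConeKernel (η * ρ) ρ x w :=
          lintegral_lintegral_swap (measurable_shellConeKernel.comp measurable_swap).aemeasurable
      _ ≤ ∫⁻ _x in closedBall (0 : EuclideanSpace ℝ (Fin m)) (η * ρ), 1 := by
          refine lintegral_mono fun x => (setLIntegral_le_lintegral _ _).trans ?_
          rw [lintegral_shellConeKernel]
          exact ENNReal.inv_mul_le_one _
      _ = ENNReal.ofReal (η ^ m) * V := by rw [setLIntegral_one, hInn]
  have hV0 : V ≠ 0 := (measure_ball_pos _ _ hρ).ne'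
  have hVt : V ≠ ∞ := measure_ball_lt_top.ne
  rw [ENNReal.ofReal_div_of_pos (by linarith), ENNReal.le_div_iff_mul_le
    (Or.inl (by simpa using hη1)) (Or.inl ofReal_ne_top)]
  rw [← ENNReal.mul_le_mul_iff_left hV0 hVt, mul_assoc]
  exact (mul_le_mul_right hVol F).trans hFR

end shellCone

theorem exists_setLIntegral_inv_norm_rpow_le {m : ℕ} {q : ℝ} (hq : (m : ℝ) < q) :
    ∃ T : ℝ, 0 < T ∧ ∀ d : ℝ, 0 < d → ∀ (x : EuclideanSpace ℝ (Fin m))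
      (S : Set (EuclideanSpace ℝ (Fin m))), (∀ y ∈ S, d ≤ ‖x - y‖) →
      ∫⁻ y in S, ENNReal.ofReal (1 / ‖x - y‖ ^ q) ≤ ENNReal.ofReal (T * d ^ ((m : ℝ) - q)) := by
  have hq0 : 0 < q := (Nat.cast_nonneg m).trans_lt hq
  set g : EuclideanSpace ℝ (Fin m) → ℝ≥0∞ := fun w => ENNReal.ofReal ((1 + ‖w‖) ^ (-q)) with hg
  have hgm : Measurable g := by fun_prop
  have hJ : ∫⁻ w, g w < ∞ := finite_integral_one_add_norm (by simpa using hq)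
  set J := ∫⁻ w, g w with hJdef
  refine ⟨2 ^ q * J.toReal + 1, by positivity, fun d hd x S hS => ?_⟩
  have hpt : ∀ y ∈ S, ENNReal.ofReal (1 / ‖x - y‖ ^ q)
      ≤ ENNReal.ofReal (2 ^ q * d ^ (-q)) * g (d⁻¹ • (x - y)) := by
    intro y hy
    have hdn := hS y hy
    rw [hg, ← ENNReal.ofReal_mul (by positivity)]
    apply ENNReal.ofReal_le_ofReal
    rw [norm_smul, norm_inv, Real.norm_of_nonneg hd.le, Real.rpow_neg hd.le,
      Real.rpow_neg (by positivity), mul_assoc, ← mul_inv, ← Real.mul_rpow hd.le (by positivity),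
      mul_add, mul_one, mul_inv_cancel_left₀ hd.ne', ← div_eq_mul_inv, div_le_div_iff₀
        (Real.rpow_pos_of_pos (by linarith) _) (by positivity), one_mul,
      ← Real.mul_rpow (by norm_num) (by positivity)]
    exact Real.rpow_le_rpow (by positivity) (by linarith) hq0.le
  calc ∫⁻ y in S, ENNReal.ofReal (1 / ‖x - y‖ ^ q)
      ≤ ∫⁻ y in S, ENNReal.ofReal (2 ^ q * d ^ (-q)) * g (d⁻¹ • (x - y)) :=
        setLIntegral_mono (by fun_prop) hpt
    _ ≤ ∫⁻ y, ENNReal.ofReal (2 ^ q * d ^ (-q)) * g (d⁻¹ • (x - y)) :=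
        setLIntegral_le_lintegral _ _
    _ = ENNReal.ofReal (2 ^ q * d ^ (-q)) * ∫⁻ y, g (d⁻¹ • y) := by
        rw [lintegral_const_mul _ (by fun_prop),
          lintegral_sub_left_eq_self (fun y => g (d⁻¹ • y)) x]
    _ = ENNReal.ofReal (2 ^ q * d ^ (-q)) * (ENNReal.ofReal (d ^ m) * J) := by
        have h := lintegral_map (μ := volume) hgm (measurable_const_smul d⁻¹
          (α := EuclideanSpace ℝ (Fin m)))
        rw [← h, Measure.map_addHaar_smul _ (inv_ne_zero hd.ne'), lintegral_smul_measure,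
          finrank_euclideanSpace_fin, abs_of_nonneg (by positivity), inv_pow, inv_inv,
          smul_eq_mul]
    _ = ENNReal.ofReal ((2 ^ q * J.toReal) * d ^ ((m : ℝ) - q)) := by
        rw [← ENNReal.ofReal_toReal hJ.ne, ← ENNReal.ofReal_mul (by positivity),
          ← ENNReal.ofReal_mul (by positivity), ENNReal.toReal_ofReal toReal_nonneg,
          sub_eq_add_neg, Real.rpow_add hd, Real.rpow_natCast]
        congr 1
        ring
    _ ≤ ENNReal.ofReal ((2 ^ q * J.toReal + 1) * d ^ ((m : ℝ) - q)) := by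
        apply ENNReal.ofReal_le_ofReal
        gcongr
        linarith

/-- Averaging the kernel against the tail of `‖x - y‖ ^ (-q)` outside `B_ρ`. -/
theorem exists_shellConeKernel_mul_tail_le {m : ℕ} (hm : 1 ≤ m) {q : ℝ} (hq : (m : ℝ) < q) :
    ∃ C : ℝ, 0 < C ∧ ∀ η ∈ Set.Ioo (0 : ℝ) 1, ∀ ρ : ℝ, 0 < ρ →
      ∀ x : EuclideanSpace ℝ (Fin m), x ≠ 0 → ‖x‖ ≤ η * ρ →
      ∀ z (S : Set (EuclideanSpace ℝ (Fin m))), (∀ y ∈ S, ρ ≤ ‖y‖) →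
        shellConeKernel (η * ρ) ρ x z * ∫⁻ y in S, ENNReal.ofReal (1 / ‖x - y‖ ^ q)
          ≤ ENNReal.ofReal (C / (1 - η)) * ENNReal.ofReal (1 / ‖x - z‖ ^ q) := by
  obtain ⟨T, hT, htail⟩ := exists_setLIntegral_inv_norm_rpow_le hq
  have hq0 : 0 < q := (Nat.cast_nonneg m).trans_lt hq
  have hωt : volume (ball (0 : EuclideanSpace ℝ (Fin m)) 1) ≠ ∞ := measure_ball_lt_top.ne
  set ω := (volume (ball (0 : EuclideanSpace ℝ (Fin m)) 1)).toReal with hω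
  have hω0 : 0 < ω := ENNReal.toReal_pos (measure_ball_pos _ _ one_pos).ne' hωt
  refine ⟨8 ^ m * T * 2 ^ q / ω, by positivity, fun η hη ρ hρ x hx0 hx z S hS => ?_⟩
  obtain ⟨hη0, hη1⟩ := id hη
  by_cases hz : z ∈ shellCone (η * ρ) ρ x
  swap
  · simp only [shellConeKernel]
    rw [Set.indicator_of_notMem hz, zero_mul]
    exact zero_le
  obtain ⟨hxz, -⟩ := norm_lt_of_mem_shellCone hz hx
  have hd : 0 < ρ - ‖x‖ := by nlinarith
  have hxz0 : 0 < ‖x - z‖ := norm_pos_iff.2 fun h => by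
    rw [sub_eq_zero.1 h] at hxz
    exact lt_irrefl _ hxz
  have h1η : 0 < 1 - η := by linarith
  have hle := norm_sub_le_of_mem_shellCone hz hx
  set d := ρ - ‖x‖ with hddef
  have hk : shellConeKernel (η * ρ) ρ x z ≤ ENNReal.ofReal (((1 - η) * (d / 8) ^ m * ω)⁻¹) := by
    simp only [shellConeKernel]
    rw [Set.indicator_of_mem hz, ENNReal.ofReal_inv_of_pos (by positivity), ENNReal.inv_le_inv,
      ENNReal.ofReal_mul (by positivity), hω, ENNReal.ofReal_toReal hωt]
    exact volume_shellCone_ge hm hη hρ hx0 hx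
  have ht := htail d hd x S fun y hy => sub_norm_le_norm_sub (hS y hy)
  refine (mul_le_mul' hk ht).trans ?_
  rw [← ENNReal.ofReal_mul (by positivity), ← ENNReal.ofReal_mul (by positivity)]
  apply ENNReal.ofReal_le_ofReal
  have h2 : ‖x - z‖ ^ q ≤ 2 ^ q * d ^ q := by
    rw [← Real.mul_rpow (by norm_num) hd.le]
    exact Real.rpow_le_rpow hxz0.le hle hq0.le
  have h3 : 1 / (2 ^ q * d ^ q) ≤ 1 / ‖x - z‖ ^ q := by gcongr
  have hdq : 0 < d ^ q := by positivity
  calc ((1 - η) * (d / 8) ^ m * ω)⁻¹ * (T * d ^ ((m : ℝ) - q))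
      = 8 ^ m * T * 2 ^ q / ω / (1 - η) * (1 / (2 ^ q * d ^ q)) := by
        rw [Real.rpow_sub hd, Real.rpow_natCast, div_pow]
        field_simp
    _ ≤ _ := by gcongr

theorem inv_norm_sub_rpow_le {m : ℕ} {q r ρ : ℝ} (hq : 0 ≤ q) {x y z : EuclideanSpace ℝ (Fin m)}
    (hz : z ∈ shellCone r ρ x) (hx : ‖x‖ ≤ r) (hy : ρ ≤ ‖y‖) :
    1 / ‖x - y‖ ^ q ≤ 3 ^ q * (1 / ‖z - y‖ ^ q) := by
  have h := norm_sub_le_three_mul hz hx hy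
  have hzy : 0 < ‖z - y‖ := norm_pos_iff.2 fun h' => by
    have := (norm_lt_of_mem_shellCone hz hx).2
    rw [sub_eq_zero.1 h'] at this
    linarith
  have hxy : 0 < ‖x - y‖ := by linarith
  rw [mul_one_div, div_le_div_iff₀ (by positivity) (by positivity), one_mul,
    ← Real.mul_rpow (by norm_num) hxy.le]
  exact Real.rpow_le_rpow hzy.le h hq

theorem add_rpow_le_two_rpow_mul {a b p : ℝ} (ha : 0 ≤ a) (hb : 0 ≤ b) (hp : 0 ≤ p) :
    (a + b) ^ p ≤ 2 ^ p * (a ^ p + b ^ p) := by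
  wlog hab : a ≤ b generalizing a b
  · rw [add_comm a b, add_comm (a ^ p)]
    exact this hb ha (le_of_not_ge hab)
  calc (a + b) ^ p ≤ (2 * b) ^ p := Real.rpow_le_rpow (by positivity) (by linarith) hp
    _ = 2 ^ p * b ^ p := Real.mul_rpow (by norm_num) hb
    _ ≤ 2 ^ p * (a ^ p + b ^ p) := by
      gcongr
      linarith [Real.rpow_nonneg ha p]

/-- If `f` is a symmetric nonnegative kernel, its double integral over a set covered by two sets
`P` and `Q` is controlled by the double integrals over `P` and `Q` and the interaction between the
differences. -/
theorem lintegral_lintegral_le_of_cover {α : Type*} [MeasurableSpace α] {μ : Measure α} [SFinite μ]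
    {f : α → α → ℝ≥0∞} (hf : Measurable (Function.uncurry f)) (hsymm : ∀ x y, f x y = f y x)
    {A P Q : Set α} (hA : A ⊆ P ∪ Q) :
    ∫⁻ x in A, ∫⁻ y in A, f x y ∂μ ∂μ ≤ ∫⁻ x in P, ∫⁻ y in P, f x y ∂μ ∂μ
      + ∫⁻ x in Q, ∫⁻ y in Q, f x y ∂μ ∂μ
      + 2 * ∫⁻ x in A \ Q, ∫⁻ y in A \ P, f x y ∂μ ∂μ := by
  have hprod : ∀ S T : Set α, ∫⁻ x in S, ∫⁻ y in T, f x y ∂μ ∂μ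
      = ∫⁻ w in S ×ˢ T, Function.uncurry f w ∂μ.prod μ :=
    fun S T => (setLIntegral_prod _ hf.aemeasurable).symm
  have hswap : ∫⁻ x in A \ P, ∫⁻ y in A \ Q, f x y ∂μ ∂μ
      = ∫⁻ x in A \ Q, ∫⁻ y in A \ P, f x y ∂μ ∂μ := by
    rw [lintegral_lintegral_swap hf.aemeasurable]
    simp_rw [hsymm]
  rw [two_mul]
  nth_rewrite 2 [← hswap]
  simp only [hprod]
  have hsub : A ×ˢ A ⊆ ((P ×ˢ P) ∪ (Q ×ˢ Q)) ∪ (((A \ Q) ×ˢ (A \ P)) ∪ ((A \ P) ×ˢ (A \ Q))) := by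
    rintro ⟨x, y⟩ ⟨hx, hy⟩
    have h1 := hA hx
    have h2 := hA hy
    simp only [Set.mem_union, Set.mem_prod, Set.mem_sdiff] at *
    tauto
  refine (lintegral_mono_set hsub).trans ?_
  refine (lintegral_union_le _ _ _).trans ?_
  exact add_le_add (lintegral_union_le _ _ _) (lintegral_union_le _ _ _)

theorem lintegral_mul_add_mul {α : Type*} [MeasurableSpace α] {μ : Measure α} (a b : ℝ≥0∞)
    {f g : α → ℝ≥0∞} (hf : Measurable f) (hg : Measurable g) :
    ∫⁻ x, a * (f x + b * g x) ∂μ = a * (∫⁻ x, f x ∂μ + b * ∫⁻ x, g x ∂μ) := by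
  rw [lintegral_const_mul a (f := fun x => f x + b * g x) (hf.add (hg.const_mul b)),
    lintegral_add_left hf, lintegral_const_mul b hg]

/-- Averaging against a transport density `k x` to an intermediate set `R`, pointwise version. -/
theorem lintegral_mul_le_of_transport {α : Type*} [MeasurableSpace α] {μ : Measure α} [SFinite μ]
    {k D κ : α → α → ℝ≥0∞} (hk : Measurable (Function.uncurry k))
    (hD : Measurable (Function.uncurry D)) (hκ : Measurable (Function.uncurry κ))
    {O R : Set α} (hO : MeasurableSet O) (hR : MeasurableSet R) {K T c : ℝ≥0∞}
    (hK : ∀ x y z, D x y ≤ K * (D x z + D z y)) {x : α} (hk0 : ∀ z, z ∉ R → k x z = 0)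
    (hone : ∫⁻ z, k x z ∂μ = 1)
    (hc : ∀ z, ∀ y ∈ O, k x z * κ x y ≤ k x z * (c * κ z y))
    (hT : ∀ z, k x z * ∫⁻ y in O, κ x y ∂μ ≤ T * κ x z) :
    ∫⁻ y in O, D x y * κ x y ∂μ ≤ K * (T * (∫⁻ z in R, D x z * κ x z ∂μ)
      + c * ∫⁻ z, k x z * ∫⁻ y in O, D z y * κ z y ∂μ ∂μ) := by
  have hkx : Measurable (k x) := hk.of_uncurry_left
  have hDx : Measurable (D x) := hD.of_uncurry_left
  have hκx : Measurable (κ x) := hκ.of_uncurry_left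
  have hm1 : Measurable fun w : α × α => k x w.2 * D x w.2 * κ x w.1 :=
    ((hkx.comp measurable_snd).mul (hDx.comp measurable_snd)).mul (hκx.comp measurable_fst)
  have hm2 : Measurable fun w : α × α => k x w.2 * (D w.2 w.1 * κ w.2 w.1) :=
    (hkx.comp measurable_snd).mul ((hD.comp measurable_swap).mul (hκ.comp measurable_swap))
  calc ∫⁻ y in O, D x y * κ x y ∂μ
      = ∫⁻ y in O, ∫⁻ z, k x z * (D x y * κ x y) ∂μ ∂μ := by
        simp_rw [lintegral_mul_const _ hkx, hone, one_mul]
    _ ≤ ∫⁻ y in O, ∫⁻ z, K * (k x z * D x z * κ x y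
          + c * (k x z * (D z y * κ z y))) ∂μ ∂μ := by
        refine setLIntegral_mono' hO fun y hy => lintegral_mono fun z => ?_
        calc k x z * (D x y * κ x y) ≤ k x z * (K * (D x z + D z y) * κ x y) := by
              gcongr
              exact hK x y z
          _ = K * (k x z * D x z * κ x y + D z y * (k x z * κ x y)) := by ring
          _ ≤ K * (k x z * D x z * κ x y + D z y * (k x z * (c * κ z y))) := by
              gcongr K * (_ + _ * ?_)
              exact hc z y hy
          _ = _ := by ring
    _ = K * ((∫⁻ y in O, ∫⁻ z, k x z * D x z * κ x y ∂μ ∂μ)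
          + c * ∫⁻ y in O, ∫⁻ z, k x z * (D z y * κ z y) ∂μ ∂μ) := by
        have e : ∀ y, ∫⁻ z, K * (k x z * D x z * κ x y + c * (k x z * (D z y * κ z y))) ∂μ
            = K * ((∫⁻ z, k x z * D x z * κ x y ∂μ)
              + c * ∫⁻ z, k x z * (D z y * κ z y) ∂μ) := by
          intro y
          have a1 : Measurable fun z => k x z * D x z * κ x y :=
            hm1.comp (measurable_prodMk_left (x := y))
          have a2 : Measurable fun z => k x z * (D z y * κ z y) :=
            hm2.comp (measurable_prodMk_left (x := y))
          exact lintegral_mul_add_mul K c a1 a2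
        simp_rw [e]
        exact lintegral_mul_add_mul K c hm1.lintegral_prod_right' hm2.lintegral_prod_right'
    _ ≤ _ := by
        gcongr K * (?_ + _ * ?_)
        · rw [lintegral_lintegral_swap hm1.aemeasurable,
            ← lintegral_const_mul T (f := fun z => D x z * κ x z) (hDx.mul hκx),
            ← lintegral_indicator hR]
          refine lintegral_mono fun z => ?_
          rw [lintegral_const_mul _ hκx]
          by_cases hz : z ∈ R
          · rw [Set.indicator_of_mem hz, mul_right_comm, mul_comm (D x z), ← mul_assoc]
            exact mul_le_mul_left (hT z) _
          · simp [hk0 z hz]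
        · rw [lintegral_lintegral_swap hm2.aemeasurable]
          refine lintegral_mono fun z => ?_
          exact (lintegral_const_mul _ (hD.of_uncurry_left.mul hκ.of_uncurry_left)).le

/-- Averaging against transport densities `k x` from `I` to an intermediate set `R` bounds the
interaction of `I` and `O` by the interactions of `I` with `R` and of `R` with `O`. -/
theorem lintegral_lintegral_mul_le_of_transport {α : Type*} [MeasurableSpace α] {μ : Measure α}
    [SFinite μ] {k D κ : α → α → ℝ≥0∞} (hk : Measurable (Function.uncurry k))
    (hD : Measurable (Function.uncurry D)) (hκ : Measurable (Function.uncurry κ))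
    {I O R : Set α} (hO : MeasurableSet O) (hR : MeasurableSet R) {K T c S : ℝ≥0∞}
    (hK : ∀ x y z, D x y ≤ K * (D x z + D z y)) (hk0 : ∀ x z, z ∉ R → k x z = 0)
    (hI : ∀ᵐ x ∂μ.restrict I, ∫⁻ z, k x z ∂μ = 1 ∧
      (∀ z, ∀ y ∈ O, k x z * κ x y ≤ k x z * (c * κ z y)) ∧
      ∀ z, k x z * ∫⁻ y in O, κ x y ∂μ ≤ T * κ x z)
    (hS : ∀ z ∈ R, ∫⁻ x in I, k x z ∂μ ≤ S) :
    ∫⁻ x in I, ∫⁻ y in O, D x y * κ x y ∂μ ∂μ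
      ≤ K * (T * (∫⁻ x in I, ∫⁻ z in R, D x z * κ x z ∂μ ∂μ)
        + c * S * ∫⁻ z in R, ∫⁻ y in O, D z y * κ z y ∂μ ∂μ) := by
  have hF : ∀ U : Set α, Measurable fun z => ∫⁻ y in U, D z y * κ z y ∂μ := fun U =>
    (hD.mul hκ).lintegral_prod_right'
  have hkF : Measurable fun w : α × α => k w.1 w.2 * ∫⁻ y in O, D w.2 y * κ w.2 y ∂μ :=
    hk.mul ((hF O).comp measurable_snd)
  have hT2 : ∫⁻ x in I, ∫⁻ z, k x z * ∫⁻ y in O, D z y * κ z y ∂μ ∂μ ∂μ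
      ≤ S * ∫⁻ z in R, ∫⁻ y in O, D z y * κ z y ∂μ ∂μ := by
    rw [lintegral_lintegral_swap hkF.aemeasurable, ← lintegral_const_mul _ (hF O),
      ← lintegral_indicator hR]
    refine lintegral_mono fun z => ?_
    rw [lintegral_mul_const _ hk.of_uncurry_right]
    by_cases hz : z ∈ R
    · rw [Set.indicator_of_mem hz]
      exact mul_le_mul_left (hS z hz) _
    · simp [hk0 _ z hz]
  calc ∫⁻ x in I, ∫⁻ y in O, D x y * κ x y ∂μ ∂μ
      ≤ ∫⁻ x in I, K * (T * (∫⁻ z in R, D x z * κ x z ∂μ)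
        + c * ∫⁻ z, k x z * ∫⁻ y in O, D z y * κ z y ∂μ ∂μ) ∂μ :=
        lintegral_mono_ae (hI.mono fun x hx =>
          lintegral_mul_le_of_transport hk hD hκ hO hR hK (hk0 x) hx.1 hx.2.1 hx.2.2)
    _ = K * (T * (∫⁻ x in I, ∫⁻ z in R, D x z * κ x z ∂μ ∂μ)
        + c * ∫⁻ x in I, ∫⁻ z, k x z * ∫⁻ y in O, D z y * κ z y ∂μ ∂μ ∂μ) := by
        have b2 : Measurable fun x => ∫⁻ z, k x z * ∫⁻ y in O, D z y * κ z y ∂μ ∂μ :=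
          hkF.lintegral_prod_right'
        rw [lintegral_mul_add_mul K c ((hF R).const_mul T) b2, lintegral_const_mul T (hF R)]
    _ ≤ _ := by
        rw [mul_assoc c]
        gcongr

/-- An interaction energy between an inner ball and an outer set is controlled by the energies
of each with the buffer zone in between. -/
theorem exists_lintegral_lintegral_le_buffer {m : ℕ} (hm : 1 ≤ m) {q : ℝ} (hq : (m : ℝ) < q) :
    ∃ C : ℝ, 0 < C ∧ ∀ η ∈ Set.Ioo (0 : ℝ) 1, ∀ ρ : ℝ, 0 < ρ →
      ∀ (D : EuclideanSpace ℝ (Fin m) → EuclideanSpace ℝ (Fin m) → ℝ≥0∞) (K : ℝ≥0∞),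
      Measurable (Function.uncurry D) → (∀ x y z, D x y ≤ K * (D x z + D z y)) →
      ∀ I O : Set (EuclideanSpace ℝ (Fin m)), MeasurableSet I → MeasurableSet O →
      I ⊆ closedBall 0 (η * ρ) → (∀ y ∈ O, ρ ≤ ‖y‖) →
      ∫⁻ x in I, ∫⁻ y in O, D x y * ENNReal.ofReal (1 / ‖x - y‖ ^ q)
        ≤ K * (ENNReal.ofReal (C / (1 - η)) *
            (∫⁻ x in I, ∫⁻ z in ball 0 ρ \ closedBall 0 (η * ρ),
              D x z * ENNReal.ofReal (1 / ‖x - z‖ ^ q))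
          + ENNReal.ofReal (3 ^ q) * ENNReal.ofReal (η ^ m / (1 - η)) *
            (∫⁻ z in ball 0 ρ \ closedBall 0 (η * ρ), ∫⁻ y in O,
              D z y * ENNReal.ofReal (1 / ‖z - y‖ ^ q))) := by
  obtain ⟨C, hC, htail⟩ := exists_shellConeKernel_mul_tail_le hm hq
  have hq0 : 0 < q := (Nat.cast_nonneg m).trans_lt hq
  refine ⟨C, hC, fun η hη ρ hρ D K hD hK I O hI hO hIη hOρ => ?_⟩
  obtain ⟨hη0, hη1⟩ := id hη
  have : NeZero m := ⟨by omega⟩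
  have hκ : Measurable (Function.uncurry
      fun x y : EuclideanSpace ℝ (Fin m) => ENNReal.ofReal (1 / ‖x - y‖ ^ q)) := by
    simp only [Function.uncurry_def]
    fun_prop
  have hne : ∀ᵐ x : EuclideanSpace ℝ (Fin m), x ≠ 0 :=
    measure_eq_zero_iff_ae_notMem.1 (measure_singleton (0 : EuclideanSpace ℝ (Fin m)))
  refine lintegral_lintegral_mul_le_of_transport (k := shellConeKernel (η * ρ) ρ)
    measurable_shellConeKernel hD hκ hO (measurableSet_ball.diff measurableSet_closedBall) hK
    (fun x z hz => Set.indicator_of_notMem (fun h => hz h.2) _) ?_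
    (fun z hz => (lintegral_mono_set hIη).trans (lintegral_shellConeKernel_left_le hm hη hρ hz))
  filter_upwards [ae_restrict_mem hI, ae_restrict_of_ae hne] with x hxI hx0
  have hx : ‖x‖ ≤ η * ρ := mem_closedBall_zero_iff.1 (hIη hxI)
  refine ⟨?_, fun z y hy => ?_, fun z => htail η hη ρ hρ x hx0 hx z O hOρ⟩
  · have hvol : volume (shellCone (η * ρ) ρ x) ≠ 0 := by
      refine (lt_of_lt_of_le ?_ (volume_shellCone_ge hm hη hρ hx0 hx)).ne'
      have hxρ : ‖x‖ < ρ := hx.trans_lt (by nlinarith)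
      refine ENNReal.mul_pos ?_ (measure_ball_pos _ _ one_pos).ne'
      rw [Ne, ENNReal.ofReal_eq_zero, not_le]
      exact mul_pos (by linarith) (pow_pos (by linarith) _)
    rw [lintegral_shellConeKernel, ENNReal.inv_mul_cancel hvol volume_shellCone_lt_top.ne]
  · by_cases hz : z ∈ shellCone (η * ρ) ρ x
    · rw [← ENNReal.ofReal_mul (by positivity)]
      gcongr
      exact inv_norm_sub_rpow_le hq0.le hz hx (hOρ y hy)
    · simp [shellConeKernel, hz]

/-- Gluing along a buffer zone: the energy on `A` is controlled by the energies on
`A ∩ B_ρ` and on `A \ closure (B_{ηρ})`. -/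
theorem gagliardo_gluing {m : ℕ} (hm : 1 ≤ m) (s p : ℝ)
    (hs : s ∈ Set.Ioo (0 : ℝ) 1) (hp : 1 ≤ p) :
    ∃ C : ℝ, 0 < C ∧
      ∀ (η : ℝ), η ∈ Set.Ioo (0 : ℝ) 1 →
      ∀ (A : Set (EuclideanSpace ℝ (Fin m))), IsOpen A →
      ∀ (ρ : ℝ), 0 < ρ →
        ball (0 : EuclideanSpace ℝ (Fin m)) ρ \ closure (ball 0 (η * ρ)) ⊆ A →
      ∀ (N : Type) [MetricSpace N] [MeasurableSpace N] [BorelSpace N],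
      ∀ (u : EuclideanSpace ℝ (Fin m) → N), Measurable u →
        gagliardoEnergy s p u A
          ≤ ENNReal.ofReal (1 + C / (1 - η) ^ (s * p + 1)) *
              gagliardoEnergy s p u (A ∩ ball 0 ρ)
            + ENNReal.ofReal (1 + C * η ^ (m : ℕ) / (1 - η)) *
              gagliardoEnergy s p u (A \ closure (ball 0 (η * ρ))) := by
  have hsp : 0 < s * p := mul_pos hs.1 (by linarith)
  obtain ⟨C, hC, hbuf⟩ := exists_lintegral_lintegral_le_buffer hm
    (q := (m : ℝ) + s * p) (by linarith)
  set q : ℝ := (m : ℝ) + s * p with hq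
  refine ⟨2 * 2 ^ p * (C + 3 ^ q), by positivity, ?_⟩
  intro η hη A hA ρ hρ hRA N _ _ _ u hu
  obtain ⟨hη0, hη1⟩ := id hη
  have h1η : 0 < 1 - η := by linarith
  rw [closure_ball _ (mul_pos hη0 hρ).ne'] at hRA ⊢
  set P := A ∩ ball 0 ρ with hP
  set Q := A \ closedBall 0 (η * ρ) with hQ
  set R : Set (EuclideanSpace ℝ (Fin m)) := ball 0 ρ \ closedBall 0 (η * ρ) with hR
  have hηρ : η * ρ < ρ := by nlinarith
  have hus := stronglyMeasurable_of_measurable_polishSpace hu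
  have hdist : Measurable fun w : EuclideanSpace ℝ (Fin m) × EuclideanSpace ℝ (Fin m) =>
      dist (u w.1) (u w.2) :=
    ((hus.comp_measurable measurable_fst).dist (hus.comp_measurable measurable_snd)).measurable
  set D : EuclideanSpace ℝ (Fin m) → EuclideanSpace ℝ (Fin m) → ℝ≥0∞ :=
    fun x y => ENNReal.ofReal (dist (u x) (u y) ^ p) with hD
  set f : EuclideanSpace ℝ (Fin m) → EuclideanSpace ℝ (Fin m) → ℝ≥0∞ :=
    fun x y => D x y * ENNReal.ofReal (1 / ‖x - y‖ ^ q) with hf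
  have hE : ∀ S, gagliardoEnergy s p u S = ∫⁻ x in S, ∫⁻ y in S, f x y := by
    intro S
    simp only [gagliardoEnergy, hf, hD, ← hq]
    simp_rw [← ENNReal.ofReal_mul (Real.rpow_nonneg dist_nonneg p), mul_one_div]
  have hDm : Measurable (Function.uncurry D) := (hdist.pow_const p).ennreal_ofReal
  have hfm : Measurable (Function.uncurry f) := by
    refine hDm.mul (Measurable.ennreal_ofReal ?_)
    fun_prop
  have hsymm : ∀ x y, f x y = f y x := fun x y => by
    simp only [hf, hD, dist_comm (u x), norm_sub_rev x]
  have htri : ∀ x y z, D x y ≤ ENNReal.ofReal (2 ^ p) * (D x z + D z y) := by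
    intro x y z
    simp only [hD]
    rw [← ENNReal.ofReal_add (by positivity) (by positivity),
      ← ENNReal.ofReal_mul (by positivity)]
    refine ENNReal.ofReal_le_ofReal (le_trans ?_
      (add_rpow_le_two_rpow_mul dist_nonneg dist_nonneg (by linarith)))
    exact Real.rpow_le_rpow dist_nonneg (dist_triangle _ _ _) (by linarith)
  have hcover : A ⊆ P ∪ Q := by
    intro x hx
    by_cases h : x ∈ ball 0 ρ
    · exact Or.inl ⟨hx, h⟩
    · exact Or.inr ⟨hx, fun h' => h (closedBall_subset_ball hηρ h')⟩
  have hAQ : A \ Q ⊆ closedBall 0 (η * ρ) := fun x hx => by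
    by_contra h
    exact hx.2 ⟨hx.1, h⟩
  have hAP : ∀ y ∈ A \ P, ρ ≤ ‖y‖ := fun y hy => by
    by_contra! h
    exact hy.2 ⟨hy.1, mem_ball_zero_iff.2 h⟩
  have hAQP : A \ Q ⊆ P := fun x hx => ⟨hx.1, closedBall_subset_ball hηρ (hAQ hx)⟩
  have hAPQ : A \ P ⊆ Q := fun y hy => (hcover hy.1).resolve_left hy.2
  have hRP : R ⊆ P := fun x hx => ⟨hRA hx, hx.1⟩
  have hRQ : R ⊆ Q := fun x hx => ⟨hRA hx, hx.2⟩
  have hmono : ∀ {S T U : Set (EuclideanSpace ℝ (Fin m))}, S ⊆ U → T ⊆ U →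
      ∫⁻ x in S, ∫⁻ y in T, f x y ≤ gagliardoEnergy s p u U := fun hS hT => by
    rw [hE]
    exact (lintegral_mono fun x => lintegral_mono_set hT).trans (lintegral_mono_set hS)
  have hPm : MeasurableSet P := hA.measurableSet.inter measurableSet_ball
  have hQm : MeasurableSet Q := hA.measurableSet.diff measurableSet_closedBall
  have hcross := hbuf η hη ρ hρ D _ hDm htri (A \ Q) (A \ P)
    (hA.measurableSet.diff hQm) (hA.measurableSet.diff hPm) hAQ hAP
  have hpow : 1 / (1 - η) ≤ 1 / (1 - η) ^ (s * p + 1) := by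
    refine one_div_le_one_div_of_le (by positivity) ?_
    simpa using Real.rpow_le_rpow_of_exponent_ge h1η (by linarith)
      (show (1 : ℝ) ≤ s * p + 1 by linarith)
  have hc1 : 1 + 2 * (2 ^ p * (C / (1 - η)))
      ≤ 1 + 2 * 2 ^ p * (C + 3 ^ q) / (1 - η) ^ (s * p + 1) := by
    calc 1 + 2 * (2 ^ p * (C / (1 - η))) = 1 + 2 * 2 ^ p * C * (1 / (1 - η)) := by ring
      _ ≤ 1 + 2 * 2 ^ p * (C + 3 ^ q) * (1 / (1 - η) ^ (s * p + 1)) := by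
          gcongr
          exact le_add_of_nonneg_right (by positivity)
      _ = _ := by ring
  have hc2 : 1 + 2 * (2 ^ p * (3 ^ q * (η ^ m / (1 - η))))
      ≤ 1 + 2 * 2 ^ p * (C + 3 ^ q) * η ^ m / (1 - η) := by
    calc 1 + 2 * (2 ^ p * (3 ^ q * (η ^ m / (1 - η))))
        = 1 + 2 * 2 ^ p * 3 ^ q * (η ^ m / (1 - η)) := by ring
      _ ≤ 1 + 2 * 2 ^ p * (C + 3 ^ q) * (η ^ m / (1 - η)) := by
          gcongr
          exact le_add_of_nonneg_left hC.le
      _ = _ := by ring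
  have hexp : ∀ {c : ℝ}, 0 ≤ c → ENNReal.ofReal (1 + 2 * (2 ^ p * c))
      = 1 + 2 * (ENNReal.ofReal (2 ^ p) * ENNReal.ofReal c) := fun hc => by
    rw [ENNReal.ofReal_add zero_le_one (by positivity), ENNReal.ofReal_mul zero_le_two,
      ENNReal.ofReal_mul (by positivity), ENNReal.ofReal_one, ENNReal.ofReal_ofNat]
  calc gagliardoEnergy s p u A
      ≤ gagliardoEnergy s p u P + gagliardoEnergy s p u Q
        + 2 * ∫⁻ x in A \ Q, ∫⁻ y in A \ P, f x y := by
        simp only [hE]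
        exact lintegral_lintegral_le_of_cover hfm hsymm hcover
    _ ≤ gagliardoEnergy s p u P + gagliardoEnergy s p u Q
        + 2 * (ENNReal.ofReal (2 ^ p) *
          (ENNReal.ofReal (C / (1 - η)) * gagliardoEnergy s p u P
          + ENNReal.ofReal (3 ^ q) * ENNReal.ofReal (η ^ m / (1 - η)) *
            gagliardoEnergy s p u Q)) := by
        gcongr _ + 2 * ?_
        refine hcross.trans ?_
        gcongr
        · exact hmono hAQP hRP
        · exact hmono hRQ hAPQ
    _ = ENNReal.ofReal (1 + 2 * (2 ^ p * (C / (1 - η)))) * gagliardoEnergy s p u P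
        + ENNReal.ofReal (1 + 2 * (2 ^ p * (3 ^ q * (η ^ m / (1 - η))))) *
          gagliardoEnergy s p u Q := by
        rw [hexp (by positivity), hexp (by positivity), ENNReal.ofReal_mul (by positivity)]
        ring
    _ ≤ _ := by gcongr
end

section
/- Let m ≥ 1, s ∈ (0,1], p ∈ (1,∞) with sp = m. Then there exists a sequence (w_n) of smooth compactly supported functions w_n : ℝ^m → [0,1] such that w_n = 1 on the unit ball B^m and E_{s,p}(w_n, ℝ^m) → 0 as n → ∞, where E_{1,p}(w) = ∫ |Dw|^p and for s < 1, E_{s,p}(w) is the Gagliardo energy ∫∫ |w(x)−w(y)|^p/|x−y|^{m+sp} dx dy. -/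
open MeasureTheory ENNReal Metric Filter

/-- The homogeneous `W^{s,p}` energy on `ℝ^m` of a real-valued function, for `s ∈ (0,1]`:
the Dirichlet energy `∫ |Dw|^p` when `s = 1`, and the Gagliardo energy otherwise. -/
noncomputable def sobolevEnergy {m : ℕ} (s p : ℝ)
    (w : EuclideanSpace ℝ (Fin m) → ℝ) : ℝ≥0∞ :=
  if s = 1 then ∫⁻ x, (‖fderiv ℝ w x‖₊ : ℝ≥0∞) ^ p
  else ∫⁻ x, ∫⁻ y, ENNReal.ofReal (|w x - w y| ^ p / ‖x - y‖ ^ ((m : ℝ) + s * p))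

lemma exists_lintegral_add_rpow_le {α : Type*} [MeasurableSpace α] {μ : Measure α} {p : ℝ}
    (hp : 1 ≤ p) {a : α → ℝ≥0∞} (ha : Measurable a) (hfin : ∫⁻ x, a x ^ p ∂μ ≠ ⊤)
    {f : ℕ → α → ℝ≥0∞} (hf : ∀ k, Measurable (f k)) {C : ℝ≥0∞} (hC : C ≠ ⊤)
    (hfC : ∀ k, ∫⁻ x, f k x ^ p ∂μ ≤ C) (h0 : ∀ x, Tendsto (fun k => f k x) atTop (nhds 0)) :
    ∃ k, ∫⁻ x, (a x + f k x) ^ p ∂μ ≤ ∫⁻ x, a x ^ p ∂μ + C + 1 := by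
  have hp0 : 0 < p := by linarith
  set M := ∫⁻ x, a x ^ p ∂μ + C
  have hM : M ≠ ⊤ := by simp [M, hfin, hC]
  have hmin : Tendsto (fun k => ∫⁻ x, (min (a x) (f k x)) ^ p ∂μ) atTop (nhds 0) := by
    have := tendsto_lintegral_of_dominated_convergence (μ := μ)
      (F := fun k x => (min (a x) (f k x)) ^ p) (f := fun _ => 0) (fun x => a x ^ p)
      (fun k => (ha.min (hf k)).pow_const p)
      (fun k => Eventually.of_forall fun x => by dsimp only; gcongr; exact min_le_left _ _)
      hfin (Eventually.of_forall fun x => by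
        have h1 : Tendsto (fun k => min (a x) (f k x)) atTop (nhds 0) :=
          tendsto_of_tendsto_of_tendsto_of_le_of_le tendsto_const_nhds (h0 x)
            (fun k => zero_le) (fun k => min_le_right _ _)
        simpa [hp0, Function.comp_def] using
          ((ENNReal.continuous_rpow_const (y := p)).tendsto 0).comp h1)
    simpa using this
  have hlim : Tendsto (fun k => (M ^ (1 / p) + (∫⁻ x, (min (a x) (f k x)) ^ p ∂μ) ^ (1 / p)) ^ p)
      atTop (nhds M) := by
    have h1 := ((ENNReal.continuous_rpow_const (y := 1 / p)).tendsto 0).comp hmin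
    have h2 := (tendsto_const_nhds (x := M ^ (1 / p))).add h1
    have h3 := ((ENNReal.continuous_rpow_const (y := p)).tendsto _).comp h2
    have h4 : (M ^ (1 / p) + (0 : ℝ≥0∞) ^ (1 / p)) ^ p = M := by
      rw [ENNReal.zero_rpow_of_pos (by positivity), add_zero, ← ENNReal.rpow_mul,
        one_div_mul_cancel hp0.ne', ENNReal.rpow_one]
    rw [h4] at h3
    exact h3
  obtain ⟨k, hk⟩ := (hlim.eventually_lt_const (ENNReal.lt_add_right hM one_ne_zero)).exists
  refine ⟨k, le_trans ?_ hk.le⟩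
  have hmax : ∫⁻ x, (max (a x) (f k x)) ^ p ∂μ ≤ M := by
    calc ∫⁻ x, (max (a x) (f k x)) ^ p ∂μ ≤ ∫⁻ x, (a x ^ p + f k x ^ p) ∂μ := by
          refine lintegral_mono fun x => ?_
          rcases max_choice (a x) (f k x) with h | h <;> simp only [h]
          · exact le_self_add
          · exact le_add_self
      _ = ∫⁻ x, a x ^ p ∂μ + ∫⁻ x, f k x ^ p ∂μ := lintegral_add_left (ha.pow_const p) _
      _ ≤ M := by exact add_le_add le_rfl (hfC k)
  have hmink := ENNReal.lintegral_Lp_add_le (μ := μ) (ha.max (hf k)).aemeasurable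
    (ha.min (hf k)).aemeasurable hp
  have heq : ∀ x, a x + f k x = (fun x => max (a x) (f k x)) x + (fun x => min (a x) (f k x)) x :=
    fun x => (max_add_min _ _).symm
  calc ∫⁻ x, (a x + f k x) ^ p ∂μ
      = ((∫⁻ x, (a x + f k x) ^ p ∂μ) ^ (1 / p)) ^ p := by
        rw [← ENNReal.rpow_mul, one_div_mul_cancel hp0.ne', ENNReal.rpow_one]
    _ ≤ (M ^ (1 / p) + (∫⁻ x, (min (a x) (f k x)) ^ p ∂μ) ^ (1 / p)) ^ p := by
        gcongr
        simp only [heq]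
        refine hmink.trans ?_
        gcongr

lemma exists_lintegral_sum_rpow_le {α : Type*} [MeasurableSpace α] {μ : Measure α} {p : ℝ}
    (hp : 1 ≤ p) {f : ℕ → α → ℝ≥0∞} (hf : ∀ k, Measurable (f k)) {C : ℝ≥0∞} (hC : C ≠ ⊤)
    (hfC : ∀ k, ∫⁻ x, f k x ^ p ∂μ ≤ C) (h0 : ∀ x, Tendsto (fun k => f k x) atTop (nhds 0))
    (n : ℕ) :
    ∃ κ : ℕ → ℕ, ∫⁻ x, (∑ i ∈ Finset.range n, f (κ i) x) ^ p ∂μ ≤ n * (C + 1) := by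
  induction n with
  | zero => exact ⟨id, by simp [show 0 < p by linarith]⟩
  | succ n ih =>
    obtain ⟨κ, hκ⟩ := ih
    obtain ⟨k, hk⟩ := exists_lintegral_add_rpow_le hp
      (Finset.measurable_fun_sum (Finset.range n) fun i _ => hf (κ i))
      (ne_top_of_le_ne_top (by finiteness) hκ) hf hC hfC h0
    refine ⟨Function.update κ n k, ?_⟩
    have hsum : ∀ x, ∑ i ∈ Finset.range (n + 1), f (Function.update κ n k i) x
        = ∑ i ∈ Finset.range n, f (κ i) x + f k x := fun x => by
      rw [Finset.sum_range_succ, Function.update_self]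
      congr 1
      refine Finset.sum_congr rfl fun i hi => ?_
      rw [Function.update_of_ne (Finset.mem_range.1 hi).ne]
    simp only [hsum]
    refine hk.trans ?_
    push_cast
    rw [add_mul, one_mul, add_assoc]
    gcongr

lemma lintegral_comp_smul_addHaar {E : Type*} [NormedAddCommGroup E] [NormedSpace ℝ E]
    [MeasurableSpace E] [BorelSpace E] [FiniteDimensional ℝ E] (μ : Measure E)
    [μ.IsAddHaarMeasure] (g : E → ℝ≥0∞) {c : ℝ} (hc : 0 < c) :
    ∫⁻ x, g (c • x) ∂μ = ENNReal.ofReal (c ^ Module.finrank ℝ E)⁻¹ * ∫⁻ x, g x ∂μ := by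
  have h := Measure.map_addHaar_smul μ hc.ne'
  rw [abs_of_pos (by positivity)] at h
  rw [← smul_eq_mul, ← lintegral_smul_measure, ← h]
  exact ((Homeomorph.smulOfNeZero c hc.ne').measurableEmbedding.lintegral_map g).symm

lemma lintegral_min_rpow_div_norm_rpow_ne_top {m : ℕ} (hm : 1 ≤ m) {p q L : ℝ} (hp : (m : ℝ) < p)
    (hq : q = 2 * m) (hL : 0 ≤ L) :
    ∫⁻ h : EuclideanSpace ℝ (Fin m), ENNReal.ofReal ((min (L * ‖h‖) 1) ^ p / ‖h‖ ^ q) ≠ ⊤ := by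
  have : Nonempty (Fin m) := ⟨⟨0, hm⟩⟩
  have hm' : (1 : ℝ) ≤ m := by exact_mod_cast hm
  have hint : Integrable (fun h : EuclideanSpace ℝ (Fin m) =>
      (min (L * ‖h‖) 1) ^ p / ‖h‖ ^ q) := by
    rw [integrable_fun_norm_addHaar volume (f := fun r : ℝ => (min (L * r) 1) ^ p / r ^ q),
      finrank_euclideanSpace_fin, ← Set.Ioc_union_Ioi_eq_Ioi (zero_le_one' ℝ)]
    refine IntegrableOn.union ?_ ?_
    · have h1 : IntegrableOn (fun r : ℝ => L ^ p * r ^ (p - m - 1)) (Set.Ioc 0 1) :=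
        ((intervalIntegrable_iff_integrableOn_Ioc_of_le zero_le_one).1
          (intervalIntegral.intervalIntegrable_rpow' (by linarith))).const_mul _
      refine Integrable.mono' h1 (by fun_prop) ?_
      filter_upwards [ae_restrict_mem measurableSet_Ioc] with r hr
      have hr0 := hr.1
      have h2 : r ^ (m - 1) = r ^ ((m : ℝ) - 1) := by
        rw [← Real.rpow_natCast, Nat.cast_sub hm, Nat.cast_one]
      rw [Real.norm_of_nonneg (by positivity), smul_eq_mul, h2]
      calc r ^ ((m : ℝ) - 1) * ((min (L * r) 1) ^ p / r ^ q)
          ≤ r ^ ((m : ℝ) - 1) * ((L * r) ^ p / r ^ q) := by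
            gcongr
            · linarith
            · exact min_le_left _ _
        _ = L ^ p * r ^ (p - m - 1) := by
            rw [Real.mul_rpow hL hr0.le, show p - m - 1 = (m - 1) + p - q by rw [hq]; ring,
              Real.rpow_sub hr0 _ q, Real.rpow_add hr0]
            ring
    · have h1 : IntegrableOn (fun r : ℝ => r ^ (-(m : ℝ) - 1)) (Set.Ioi 1) :=
        integrableOn_Ioi_rpow_of_lt (by linarith) one_pos
      refine Integrable.mono' h1 (by fun_prop) ?_
      filter_upwards [ae_restrict_mem measurableSet_Ioi] with r hr
      have hr0 : 0 < r := one_pos.trans hr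
      have h2 : r ^ (m - 1) = r ^ ((m : ℝ) - 1) := by
        rw [← Real.rpow_natCast, Nat.cast_sub hm, Nat.cast_one]
      rw [Real.norm_of_nonneg (by positivity), smul_eq_mul, h2]
      calc r ^ ((m : ℝ) - 1) * ((min (L * r) 1) ^ p / r ^ q)
          ≤ r ^ ((m : ℝ) - 1) * (1 / r ^ q) := by
            gcongr
            refine Real.rpow_le_one (by positivity) (min_le_right _ _) (by linarith)
        _ = r ^ (-(m : ℝ) - 1) := by
            rw [show -(m : ℝ) - 1 = (m - 1) - q by rw [hq]; ring,
              Real.rpow_sub hr0 _ q]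
            ring
  exact hint.lintegral_lt_top.ne

lemma exists_average_tendsto_zero {E α : Type*} [MeasurableSpace α] {μ : Measure α} {p : ℝ}
    (hp : 1 < p) (J : (E → ℝ) → ℝ≥0∞) (A : (E → ℝ) → α → ℝ≥0∞) (φ : ℕ → E → ℝ)
    (hA : ∀ k, Measurable (A (φ k))) {C : ℝ≥0∞} (hC : C ≠ ⊤)
    (hAC : ∀ k, ∫⁻ z, A (φ k) z ^ p ∂μ ≤ C)
    (h0 : ∀ z, Tendsto (fun k => A (φ k) z) atTop (nhds 0))
    (hJ : ∀ (κ : ℕ → ℕ) (n : ℕ) (c : ℝ), 0 ≤ c →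
      J (fun x => c * ∑ i ∈ Finset.range n, φ (κ i) x) ≤
        ∫⁻ z, (ENNReal.ofReal c * ∑ i ∈ Finset.range n, A (φ (κ i)) z) ^ p ∂μ) :
    ∃ κ : ℕ → ℕ → ℕ, Tendsto (fun n : ℕ =>
      J (fun x => ((n : ℝ) + 1)⁻¹ * ∑ i ∈ Finset.range (n + 1), φ (κ n i) x)) atTop (nhds 0) := by
  choose κ hκ using fun n : ℕ => exists_lintegral_sum_rpow_le hp.le hA hC hAC h0 (n + 1)
  have hC1 : C + 1 ≠ ⊤ := by finiteness
  have hbound : ∀ n : ℕ, J (fun x => ((n : ℝ) + 1)⁻¹ * ∑ i ∈ Finset.range (n + 1), φ (κ n i) x) ≤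
      ENNReal.ofReal (((n : ℝ) + 1) ^ (-(p - 1))) * (C + 1) := fun n => by
    have hn : (0 : ℝ) < n + 1 := by positivity
    refine (hJ (κ n) (n + 1) _ (by positivity)).trans ?_
    simp only [ENNReal.mul_rpow_of_nonneg _ _ (zero_le_one.trans hp.le)]
    rw [lintegral_const_mul' _ _ (by finiteness)]
    refine (mul_le_mul_right (hκ n) _).trans ?_
    rw [← mul_assoc, show ((n + 1 : ℕ) : ℝ≥0∞) = ENNReal.ofReal ((n : ℝ) + 1) by
      rw [← ENNReal.ofReal_natCast]; push_cast; rfl,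
      ENNReal.ofReal_rpow_of_nonneg (by positivity) (by linarith),
      ← ENNReal.ofReal_mul (by positivity)]
    gcongr
    rw [Real.inv_rpow hn.le, neg_sub, Real.rpow_sub hn, Real.rpow_one, div_eq_inv_mul]
  refine ⟨κ, tendsto_of_tendsto_of_tendsto_of_le_of_le tendsto_const_nhds ?_
    (fun n => zero_le) hbound⟩
  have h1 : Tendsto (fun n : ℕ => ((n : ℝ) + 1) ^ (-(p - 1))) atTop (nhds 0) :=
    (tendsto_rpow_neg_atTop (by linarith)).comp
      (tendsto_atTop_add_const_right _ _ tendsto_natCast_atTop_atTop)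
  simpa using ENNReal.Tendsto.mul_const (ENNReal.tendsto_ofReal h1) (Or.inr hC1)

lemma gagliardo_lintegral_ne_top {m : ℕ} (hm : 1 ≤ m) {p q : ℝ} (hp : (m : ℝ) < p)
    (hq : q = 2 * m) {φ : EuclideanSpace ℝ (Fin m) → ℝ} (hφ : ContDiff ℝ 1 φ)
    (hsupp : HasCompactSupport φ) (h01 : ∀ x, φ x ∈ Set.Icc (0 : ℝ) 1) :
    ∫⁻ x, ∫⁻ y, ENNReal.ofReal (|φ x - φ y| ^ p / ‖x - y‖ ^ q) ≠ ⊤ := by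
  have hp0 : 0 < p := (Nat.cast_nonneg m).trans_lt hp
  obtain ⟨L, hL⟩ := hφ.lipschitzWith_of_hasCompactSupport hsupp one_ne_zero
  set K := tsupport φ
  have hK : MeasurableSet K := (isClosed_tsupport φ).measurableSet
  set g : EuclideanSpace ℝ (Fin m) → ℝ≥0∞ :=
    fun h => ENNReal.ofReal ((min (L * ‖h‖) 1) ^ p / ‖h‖ ^ q)
  have hg : Measurable g := by fun_prop
  have hI : ∫⁻ h, g h ≠ ⊤ := lintegral_min_rpow_div_norm_rpow_ne_top hm hp hq L.2
  set F : EuclideanSpace ℝ (Fin m) → EuclideanSpace ℝ (Fin m) → ℝ≥0∞ :=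
    fun x y => K.indicator 1 x * g (x - y)
  set G : EuclideanSpace ℝ (Fin m) → EuclideanSpace ℝ (Fin m) → ℝ≥0∞ :=
    fun x y => K.indicator 1 y * g (x - y)
  have hind : Measurable (K.indicator (1 : EuclideanSpace ℝ (Fin m) → ℝ≥0∞)) := measurable_one.indicator hK
  have hF : Measurable (Function.uncurry F) := by
    unfold F Function.uncurry; fun_prop
  have hG : Measurable (Function.uncurry G) := by
    unfold G Function.uncurry; fun_prop
  have hle : ∀ x y, ENNReal.ofReal (|φ x - φ y| ^ p / ‖x - y‖ ^ q) ≤ F x y + G x y := by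
    intro x y
    have h1 : ENNReal.ofReal (|φ x - φ y| ^ p / ‖x - y‖ ^ q) ≤ g (x - y) := by
      unfold g
      gcongr
      refine le_min ?_ ?_
      · simpa [Real.dist_eq, dist_eq_norm] using hL.dist_le_mul x y
      · rw [abs_le]
        constructor <;> linarith [(h01 x).1, (h01 x).2, (h01 y).1, (h01 y).2]
    by_cases hx : x ∈ K
    · simpa [F, hx] using h1.trans le_self_add
    by_cases hy : y ∈ K
    · simpa [G, hy] using h1.trans le_add_self
    simp [image_eq_zero_of_notMem_tsupport hx, image_eq_zero_of_notMem_tsupport hy, hp0.ne']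
  have hFint : ∫⁻ x, ∫⁻ y, F x y = volume K * ∫⁻ h, g h := by
    have : ∀ x, ∫⁻ y, F x y = K.indicator 1 x * ∫⁻ h, g h := fun x => by
      unfold F
      rw [lintegral_const_mul _ (by fun_prop), lintegral_sub_left_eq_self g x]
    simp only [this]
    rw [lintegral_mul_const _ hind, lintegral_indicator_one hK]
  have hGint : ∫⁻ x, ∫⁻ y, G x y = volume K * ∫⁻ h, g h := by
    rw [lintegral_lintegral_swap hG.aemeasurable]
    have : ∀ y, ∫⁻ x, G x y = K.indicator 1 y * ∫⁻ h, g h := fun y => by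
      unfold G
      rw [lintegral_const_mul _ (by fun_prop), lintegral_sub_right_eq_self g y]
    simp only [this]
    rw [lintegral_mul_const _ hind, lintegral_indicator_one hK]
  refine ne_top_of_le_ne_top (b := (volume K * ∫⁻ h, g h) + volume K * ∫⁻ h, g h) ?_ ?_
  · have hKfin : volume K ≠ ⊤ := hsupp.isCompact.measure_lt_top.ne
    have := ENNReal.mul_ne_top hKfin hI
    exact ENNReal.add_ne_top.2 ⟨this, this⟩
  · calc ∫⁻ x, ∫⁻ y, ENNReal.ofReal (|φ x - φ y| ^ p / ‖x - y‖ ^ q)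
        ≤ ∫⁻ x, ∫⁻ y, (F x y + G x y) := lintegral_mono fun x => lintegral_mono fun y => hle x y
      _ = ∫⁻ x, ((∫⁻ y, F x y) + ∫⁻ y, G x y) := by
          congr 1 with x
          exact lintegral_add_left (hF.comp measurable_prodMk_left) _
      _ = (∫⁻ x, ∫⁻ y, F x y) + ∫⁻ x, ∫⁻ y, G x y :=
          lintegral_add_left hF.lintegral_prod_right' _
      _ = _ := by rw [hFint, hGint]

lemma gagliardo_lintegral_comp_smul {m : ℕ} {p q : ℝ} (hq : q = 2 * m)
    (φ : EuclideanSpace ℝ (Fin m) → ℝ) {c : ℝ} (hc : 0 < c) :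
    ∫⁻ x, ∫⁻ y, ENNReal.ofReal (|φ (c • x) - φ (c • y)| ^ p / ‖x - y‖ ^ q) =
      ∫⁻ x, ∫⁻ y, ENNReal.ofReal (|φ x - φ y| ^ p / ‖x - y‖ ^ q) := by
  set H : EuclideanSpace ℝ (Fin m) → EuclideanSpace ℝ (Fin m) → ℝ≥0∞ :=
    fun x y => ENNReal.ofReal (|φ x - φ y| ^ p / ‖x - y‖ ^ q)
  have h1 : ∀ x y, ENNReal.ofReal (|φ (c • x) - φ (c • y)| ^ p / ‖x - y‖ ^ q) =
      ENNReal.ofReal (c ^ q) * H (c • x) (c • y) := fun x y => by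
    unfold H
    rw [← ENNReal.ofReal_mul (by positivity), ← smul_sub, norm_smul, Real.norm_of_nonneg hc.le,
      Real.mul_rpow hc.le (norm_nonneg _)]
    congr 1
    have := (Real.rpow_pos_of_pos hc q).ne'
    field_simp
  have hcm : ENNReal.ofReal (c ^ q) *
      (ENNReal.ofReal (c ^ m)⁻¹ * ENNReal.ofReal (c ^ m)⁻¹) = 1 := by
    rw [← ENNReal.ofReal_mul (by positivity), ← ENNReal.ofReal_mul (by positivity), hq, two_mul,
      Real.rpow_add hc, Real.rpow_natCast, ← ENNReal.ofReal_one]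
    congr 1
    field_simp
  simp only [h1]
  simp only [lintegral_const_mul' _ _ ENNReal.ofReal_ne_top]
  simp only [fun x => lintegral_comp_smul_addHaar volume (H (c • x)) hc]
  simp only [lintegral_const_mul' _ _ ENNReal.ofReal_ne_top]
  rw [lintegral_comp_smul_addHaar volume (fun x => ∫⁻ y, H x y) hc, finrank_euclideanSpace_fin,
    ← mul_assoc, ← mul_assoc, mul_assoc (ENNReal.ofReal (c ^ q)), hcm, one_mul]

lemma dirichlet_lintegral_comp_smul {m : ℕ} {φ : EuclideanSpace ℝ (Fin m) → ℝ} {c : ℝ}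
    (hc : 0 < c) :
    ∫⁻ x, (‖fderiv ℝ (fun x => φ (c • x)) x‖₊ : ℝ≥0∞) ^ (m : ℝ) =
      ∫⁻ x, (‖fderiv ℝ φ x‖₊ : ℝ≥0∞) ^ (m : ℝ) := by
  have h1 : ∀ x, (‖fderiv ℝ (fun x => φ (c • x)) x‖₊ : ℝ≥0∞) ^ (m : ℝ) =
      ENNReal.ofReal (c ^ m) * (‖fderiv ℝ φ (c • x)‖₊ : ℝ≥0∞) ^ (m : ℝ) := fun x => by
    rw [fderiv_comp_smul, ← enorm_eq_nnnorm, enorm_smul,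
      ENNReal.mul_rpow_of_nonneg _ _ (by positivity), Real.enorm_of_nonneg hc.le, ENNReal.rpow_natCast, ENNReal.ofReal_pow hc.le]
    rfl
  simp only [h1]
  rw [lintegral_const_mul' _ _ ENNReal.ofReal_ne_top,
    lintegral_comp_smul_addHaar volume (fun x => (‖fderiv ℝ φ x‖₊ : ℝ≥0∞) ^ (m : ℝ)) hc,
    finrank_euclideanSpace_fin, ← mul_assoc, ← ENNReal.ofReal_mul (by positivity),
    mul_inv_cancel₀ (by positivity), ENNReal.ofReal_one, one_mul]

lemma dirichlet_lintegral_ne_top {m : ℕ} {p : ℝ} (hp : 0 < p) {φ : EuclideanSpace ℝ (Fin m) → ℝ}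
    (hφ : ContDiff ℝ 1 φ) (hsupp : HasCompactSupport φ) :
    ∫⁻ x, (‖fderiv ℝ φ x‖₊ : ℝ≥0∞) ^ p ≠ ⊤ := by
  have h := (hφ.continuous_fderiv one_ne_zero).memLp_of_hasCompactSupport (μ := volume)
    (p := ENNReal.ofReal p) (hsupp.fderiv ℝ)
  have := lintegral_rpow_enorm_lt_top_of_eLpNorm_lt_top (by simpa using hp)
    ENNReal.ofReal_ne_top h.2
  rw [ENNReal.toReal_ofReal hp.le] at this
  exact this.ne

lemma exists_average_sobolevEnergy_tendsto_zero {m : ℕ} (hm : 1 ≤ m) {s p : ℝ}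
    (hs : s ∈ Set.Ioc (0 : ℝ) 1) (hp : 1 < p) (hsp : s * p = m)
    (φ : EuclideanSpace ℝ (Fin m) → ℝ) (hφ : ContDiff ℝ 1 φ) (hsupp : HasCompactSupport φ)
    (h01 : ∀ x, φ x ∈ Set.Icc (0 : ℝ) 1) (hφ1 : ∀ x ∈ ball 0 1, φ x = 1) :
    ∃ κ : ℕ → ℕ → ℕ, Tendsto (fun n : ℕ => sobolevEnergy s p (fun x =>
      ((n : ℝ) + 1)⁻¹ * ∑ i ∈ Finset.range (n + 1), φ (((κ n i : ℝ) + 1)⁻¹ • x)))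
      atTop (nhds 0) := by
  set ψ : ℕ → EuclideanSpace ℝ (Fin m) → ℝ := fun k x => φ (((k : ℝ) + 1)⁻¹ • x)
  have hψ : ∀ k, ContDiff ℝ 1 (ψ k) := fun k => hφ.comp (contDiff_const_smul _)
  have hp0 : 0 < p := by linarith
  have hpos : ∀ k : ℕ, (0 : ℝ) < ((k : ℝ) + 1)⁻¹ := fun k => by positivity
  have hlocal : ∀ x, ∀ᶠ k in atTop, ψ k =ᶠ[nhds x] fun _ => 1 := fun x => by
    obtain ⟨N, hN⟩ := exists_nat_gt ‖x‖
    filter_upwards [eventually_ge_atTop N] with k hk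
    have hxk : ‖x‖ < (k : ℝ) + 1 := by
      have : (N : ℝ) ≤ k := by exact_mod_cast hk
      linarith
    filter_upwards [(continuous_norm.tendsto x).eventually_lt_const hxk] with y hy
    refine hφ1 _ (mem_ball_zero_iff.2 ?_)
    rw [norm_smul, Real.norm_of_nonneg (hpos k).le, inv_mul_lt_iff₀ (by positivity)]
    linarith
  by_cases hs1 : s = 1
  · have hpm : p = m := by rw [← hsp, hs1, one_mul]
    refine exists_average_tendsto_zero (μ := volume) hp (sobolevEnergy s p)
      (fun w x => (‖fderiv ℝ w x‖₊ : ℝ≥0∞)) ψ (fun k => by fun_prop)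
      (dirichlet_lintegral_ne_top hp0 hφ hsupp)
      (fun k => by rw [hpm]; exact (dirichlet_lintegral_comp_smul (hpos k)).le) (fun x => ?_)
      fun κ n c hc => ?_
    · refine tendsto_const_nhds.congr' ?_
      filter_upwards [hlocal x] with k hk
      simp [hk.fderiv_eq]
    · rw [sobolevEnergy, if_pos hs1]
      refine lintegral_mono fun x => ENNReal.rpow_le_rpow ?_ hp0.le
      have hd : ∀ i ∈ Finset.range n, DifferentiableAt ℝ (ψ (κ i)) x :=
        fun i _ => ((hψ (κ i)).differentiable one_ne_zero) x
      rw [fderiv_const_mul (DifferentiableAt.fun_sum hd), fderiv_fun_sum hd,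
        ← enorm_eq_nnnorm, enorm_smul, Real.enorm_of_nonneg hc]
      gcongr
      exact enorm_sum_le (Finset.range n) fun i => fderiv ℝ (ψ (κ i)) x
  · have hs' : s < 1 := lt_of_le_of_ne hs.2 hs1
    set q : ℝ := m + s * p
    have hq : q = 2 * m := by simp only [q, hsp]; ring
    have hmp : (m : ℝ) < p := by rw [← hsp]; nlinarith
    have hpow : ∀ (w : EuclideanSpace ℝ (Fin m) → ℝ) x y,
        ENNReal.ofReal (|w x - w y| / ‖x - y‖ ^ (q / p)) ^ p =
          ENNReal.ofReal (|w x - w y| ^ p / ‖x - y‖ ^ q) := fun w x y => by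
      rw [ENNReal.ofReal_rpow_of_nonneg (by positivity) hp0.le,
        Real.div_rpow (abs_nonneg _) (by positivity), ← Real.rpow_mul (norm_nonneg _),
        div_mul_cancel₀ _ hp0.ne']
    have henergy : ∀ w : EuclideanSpace ℝ (Fin m) → ℝ, Continuous w →
        ∫⁻ z : EuclideanSpace ℝ (Fin m) × EuclideanSpace ℝ (Fin m),
          ENNReal.ofReal (|w z.1 - w z.2| / ‖z.1 - z.2‖ ^ (q / p)) ^ p =
        ∫⁻ x, ∫⁻ y, ENNReal.ofReal (|w x - w y| ^ p / ‖x - y‖ ^ q) := fun w hw => by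
      have := hw.measurable
      simp only [hpow]
      rw [Measure.volume_eq_prod, lintegral_prod _ (by fun_prop)]
    have hψc : ∀ k, Continuous (ψ k) := fun k => (hψ k).continuous
    refine exists_average_tendsto_zero (μ := volume) hp (sobolevEnergy s p)
      (fun w (z : EuclideanSpace ℝ (Fin m) × EuclideanSpace ℝ (Fin m)) =>
        ENNReal.ofReal (|w z.1 - w z.2| / ‖z.1 - z.2‖ ^ (q / p))) ψ
      (fun k => by have := (hψc k).measurable; fun_prop)
      (gagliardo_lintegral_ne_top hm hmp hq hφ hsupp h01)
      (fun k => by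
        rw [henergy _ (hψc k)]
        exact (gagliardo_lintegral_comp_smul hq φ (hpos k)).le)
      (fun z => ?_) fun κ n c hc => ?_
    · refine tendsto_const_nhds.congr' ?_
      filter_upwards [hlocal z.1, hlocal z.2] with k hk1 hk2
      simp [hk1.eq_of_nhds, hk2.eq_of_nhds]
    · rw [sobolevEnergy, if_neg hs1, ← henergy _ (by fun_prop)]
      refine lintegral_mono fun z => ENNReal.rpow_le_rpow ?_ hp0.le
      rw [← ENNReal.ofReal_sum_of_nonneg fun i _ => by positivity, ← ENNReal.ofReal_mul hc,
        ← Finset.sum_div, ← mul_div_assoc, ← mul_sub, ← Finset.sum_sub_distrib, abs_mul,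
        abs_of_nonneg hc]
      gcongr
      exact Finset.abs_sum_le_sum_abs _ _

lemma hasCompactSupport_finset_sum {ι X M : Type*} [TopologicalSpace X] [AddCommMonoid M]
    (t : Finset ι) {f : ι → X → M} (hf : ∀ i, HasCompactSupport (f i)) :
    HasCompactSupport fun x => ∑ i ∈ t, f i x := by
  classical
  induction t using Finset.induction_on with
  | empty => simpa [Pi.zero_def] using HasCompactSupport.zero (α := X) (β := M)
  | insert i t hi ih =>
    simp only [Finset.sum_insert hi]
    exact (hf i).add ih

/-- Null critical capacity of points: if `sp = m`, there are smooth compactly supported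
functions with values in `[0,1]`, equal to `1` on the unit ball, and arbitrarily small
critical Sobolev energy. -/
theorem null_critical_capacity {m : ℕ} (hm : 1 ≤ m) (s p : ℝ)
    (hs : s ∈ Set.Ioc (0 : ℝ) 1) (hp : 1 < p) (hsp : s * p = m) :
    ∃ w : ℕ → EuclideanSpace ℝ (Fin m) → ℝ,
      (∀ n, ContDiff ℝ (⊤ : ℕ∞) (w n)) ∧
      (∀ n, HasCompactSupport (w n)) ∧
      (∀ n x, w n x ∈ Set.Icc (0 : ℝ) 1) ∧
      (∀ n, ∀ x ∈ ball (0 : EuclideanSpace ℝ (Fin m)) 1, w n x = 1) ∧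
      Tendsto (fun n => sobolevEnergy s p (w n)) atTop (nhds 0) := by
  let b : ContDiffBump (0 : EuclideanSpace ℝ (Fin m)) := ⟨1, 2, one_pos, one_lt_two⟩
  have hb1 : ∀ x ∈ ball (0 : EuclideanSpace ℝ (Fin m)) 1, b x = 1 :=
    fun x hx => b.one_of_mem_closedBall (ball_subset_closedBall hx)
  obtain ⟨κ, hκ⟩ := exists_average_sobolevEnergy_tendsto_zero hm hs hp hsp b b.contDiff
    b.hasCompactSupport (fun x => ⟨b.nonneg, b.le_one⟩) hb1
  refine ⟨_, fun n => ?_, fun n => ?_, fun n x => ?_, fun n x hx => ?_, hκ⟩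
  · exact contDiff_const.mul (ContDiff.sum fun i _ => b.contDiff.comp (contDiff_const_smul _))
  · refine HasCompactSupport.mul_left (hasCompactSupport_finset_sum _ fun i => ?_)
    exact b.hasCompactSupport.comp_smul (by positivity)
  · have hn : (0 : ℝ) < n + 1 := by positivity
    refine ⟨mul_nonneg (by positivity) (Finset.sum_nonneg fun i _ => b.nonneg), ?_⟩
    rw [inv_mul_le_iff₀ hn, mul_one]
    refine (Finset.sum_le_card_nsmul _ _ 1 fun i _ => b.le_one).trans ?_
    simp
  · have hn : (n : ℝ) + 1 ≠ 0 := by positivity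
    rw [Finset.sum_congr rfl fun i _ => hb1 _ ?_]
    · simp [hn]
    · rw [mem_ball_zero_iff] at hx ⊢
      rw [norm_smul, Real.norm_of_nonneg (by positivity), inv_mul_lt_iff₀ (by positivity)]
      have : (0 : ℝ) ≤ κ n i := by positivity
      linarith
end

section
/- Let m ≥ 1, s ∈ (0,1), p ∈ [1,∞), λ > 1, η ∈ (0,λ). There is a constant C > 0 (depending only on m, s, p, λ, η) such that for every ρ > 0, every measurable map u : B_{λρ} → N into a metric space N, and every Lipschitz map φ : B_{(1+η)ρ} → B_{(λ−η)ρ}, there exists a ∈ B_{ηρ} with E_{s,p}(u ∘ (φ(· − a) + a), B_ρ) ≤ C · Lip(φ)^{sp} · E_{s,p}(u, B_{λρ}). -/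
open MeasureTheory ENNReal NNReal Metric

open Filter Topology

section
variable {E N : Type*} [NormedAddCommGroup E]

/-- Fatou: an integral of lower semicontinuous functions of a parameter is lower semicontinuous. -/
theorem lowerSemicontinuous_lintegral {P X : Type*} [TopologicalSpace P]
    [FirstCountableTopology P] [MeasurableSpace X] {μ : Measure X} {f : P → X → ℝ≥0∞}
    (hf : ∀ p, Measurable (f p)) (hc : ∀ x, LowerSemicontinuous fun p => f p x) :
    LowerSemicontinuous fun p => ∫⁻ x, f p x ∂μ := by
  rw [lowerSemicontinuous_iff_le_liminf]
  intro p
  refine le_trans (lintegral_mono fun x => ?_) (lintegral_liminf_le (u := 𝓝 p) hf)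
  exact LowerSemicontinuousAt.le_liminf (hc x p)

/-- The integral of `dist (u x) (u ξ) ^ p / ‖x - ξ‖ ^ q` over the `ξ ∈ A` with `‖ξ - x‖ < t`. -/
noncomputable def truncatedEnergy [MeasurableSpace E] [PseudoMetricSpace N] (μ : Measure E)
    (u : E → N) (A : Set E) (p q : ℝ) (x : E) (t : ℝ) : ℝ≥0∞ :=
  ∫⁻ ξ in A ∩ ball x t, ENNReal.ofReal (dist (u x) (u ξ) ^ p / ‖x - ξ‖ ^ q) ∂μ

theorem measurable_truncatedEnergy [MeasurableSpace E] [BorelSpace E] [SecondCountableTopology E]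
    [PseudoMetricSpace N] [MeasurableSpace N] [BorelSpace N] (μ : Measure E) {u : E → N}
    (hu : Measurable u) {A : Set E} (hA : MeasurableSet A) {p q : ℝ} (hp : 0 < p) (hq : 0 < q) :
    Measurable fun z : E × ℝ => truncatedEnergy μ u A p q z.1 z.2 := by
  let f : N × (E × ℝ) → E → ℝ≥0∞ := fun z => (A ∩ ball z.2.1 z.2.2).indicator
    fun ξ => ENNReal.ofReal (dist z.1 (u ξ) ^ p / ‖z.2.1 - ξ‖ ^ q)
  have hf : ∀ z, Measurable (f z) := fun z => by
    refine Measurable.indicator ?_ (hA.inter measurableSet_ball)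
    have : Measurable fun ξ => dist z.1 (u ξ) :=
      (continuous_const.dist continuous_id).measurable.comp hu
    fun_prop
  have hc : ∀ ξ, LowerSemicontinuous fun z => f z ξ := by
    intro ξ z c hcz
    have hne : f z ξ ≠ 0 := (zero_le.trans_lt hcz).ne'
    have hmem : ξ ∈ A ∩ ball z.2.1 z.2.2 := Set.mem_of_indicator_ne_zero hne
    have hopen : ∀ᶠ w : N × (E × ℝ) in 𝓝 z, ξ ∈ ball w.2.1 w.2.2 := by
      have : IsOpen {w : N × (E × ℝ) | dist ξ w.2.1 < w.2.2} :=
        isOpen_lt (by fun_prop) (by fun_prop)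
      exact this.mem_nhds hmem.2
    have hval : f z ξ = ENNReal.ofReal (dist z.1 (u ξ) ^ p / ‖z.2.1 - ξ‖ ^ q) :=
      Set.indicator_of_mem hmem _
    have hx : ‖z.2.1 - ξ‖ ≠ 0 := by
      intro h
      rw [hval, h, Real.zero_rpow hq.ne'] at hne
      simp at hne
    have hcont : ContinuousAt (fun w : N × (E × ℝ) =>
        ENNReal.ofReal (dist w.1 (u ξ) ^ p / ‖w.2.1 - ξ‖ ^ q)) z := by
      refine ENNReal.continuous_ofReal.continuousAt.comp (ContinuousAt.div ?_ ?_ ?_)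
      · exact ContinuousAt.rpow_const (by fun_prop) (Or.inr hp.le)
      · exact ContinuousAt.rpow_const (by fun_prop) (Or.inl hx)
      · exact (Real.rpow_pos_of_pos ((norm_nonneg _).lt_of_ne' hx) _).ne'
    change c < f z ξ at hcz
    rw [hval] at hcz
    filter_upwards [hopen, hcont.eventually (lt_mem_nhds hcz)] with w hw hw'
    have : f w ξ = _ := Set.indicator_of_mem (show ξ ∈ A ∩ ball w.2.1 w.2.2 from ⟨hmem.1, hw⟩) _
    rwa [this]
  have h := ((lowerSemicontinuous_lintegral (μ := μ) hf hc).measurable).comp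
    ((hu.comp measurable_fst).prodMk measurable_id : Measurable fun z : E × ℝ => (u z.1, z))
  convert h using 2 with z
  rw [truncatedEnergy, Function.comp_apply, ← lintegral_indicator (hA.inter measurableSet_ball)]
  rfl

theorem ofReal_dist_rpow_le {N : Type*} [PseudoMetricSpace N] {p : ℝ} (hp : 1 ≤ p) (a b c : N) :
    ENNReal.ofReal (dist a b ^ p) ≤
      2 ^ (p - 1) * (ENNReal.ofReal (dist a c ^ p) + ENNReal.ofReal (dist b c ^ p)) := by
  have hp0 : 0 ≤ p := by linarith
  simp only [← ENNReal.ofReal_rpow_of_nonneg dist_nonneg hp0]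
  refine le_trans ?_ (ENNReal.rpow_add_le_mul_rpow_add_rpow _ _ hp)
  rw [← ENNReal.ofReal_add dist_nonneg dist_nonneg]
  gcongr
  exact dist_triangle_right a b c

variable [NormedSpace ℝ E]

theorem exists_ball_subset_ball_inter {R : ℝ} {x y : E} (hx : x ∈ ball (0 : E) R)
    (hy : y ∈ ball (0 : E) R) (hxy : x ≠ y) :
    ∃ c, ball c (dist x y / 2) ⊆ ball 0 R ∩ ball x (2 * dist x y) ∩ ball y (2 * dist x y) := by
  have hr : 0 < dist x y := dist_pos.2 hxy
  rw [mem_ball_zero_iff] at hx hy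
  have hR : 0 < R := (norm_nonneg x).trans_lt hx
  have hle : dist x y ≤ 2 * R := by
    rw [dist_eq_norm]; linarith [norm_sub_le x y]
  set r := dist x y with hrdef
  have ht1 : r / (2 * R) ≤ 1 := (div_le_one (by positivity)).2 hle
  have ht0 : 0 < r / (2 * R) := by positivity
  have htR : r / (2 * R) * R = r / 2 := by field_simp
  set t := r / (2 * R)
  have hcx : dist ((1 - t) • x) x ≤ r / 2 := by
    rw [dist_eq_norm, show (1 - t) • x - x = (-t) • x by module, norm_smul, norm_neg,
      Real.norm_of_nonneg ht0.le, ← htR]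
    gcongr
  have hc0 : ‖(1 - t) • x‖ + r / 2 ≤ R := by
    rw [norm_smul, Real.norm_of_nonneg (by linarith), ← htR]
    nlinarith
  refine ⟨(1 - t) • x, fun ξ hξ => ?_⟩
  rw [mem_ball] at hξ
  have h1 : dist ξ x < r := by linarith [dist_triangle ξ ((1 - t) • x) x]
  refine ⟨⟨?_, ?_⟩, ?_⟩
  · rw [mem_ball_zero_iff]
    have := norm_le_norm_add_norm_sub ((1 - t) • x) ξ
    rw [← dist_eq_norm, dist_comm] at this
    linarith
  · rw [mem_ball]; linarith
  · rw [mem_ball]; linarith [dist_triangle ξ x y]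

variable [MeasurableSpace E] [BorelSpace E] [FiniteDimensional ℝ E]

theorem ofReal_dist_rpow_le_truncatedEnergy [PseudoMetricSpace N] [MeasurableSpace N]
    [BorelSpace N] (μ : Measure E) [μ.IsAddHaarMeasure] {u : E → N} (hu : Measurable u)
    {p q R t : ℝ} (hp : 1 ≤ p) (hq : q = Module.finrank ℝ E) {x y : E} (hx : x ∈ ball (0 : E) R)
    (hy : y ∈ ball (0 : E) R) (hxy : dist x y ≤ t) :
    ENNReal.ofReal (dist (u x) (u y) ^ p) ≤
      2 ^ (p - 1) * ENNReal.ofReal (4 ^ q) * (μ (ball 0 1))⁻¹ *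
        (truncatedEnergy μ u (ball 0 R) p q x (2 * t) +
          truncatedEnergy μ u (ball 0 R) p q y (2 * t)) := by
  rcases eq_or_ne x y with rfl | hne
  · simp [Real.zero_rpow (show p ≠ 0 by linarith)]
  have hr : 0 < dist x y := dist_pos.2 hne
  have hq0 : 0 ≤ q := hq ▸ Nat.cast_nonneg _
  obtain ⟨c, hc⟩ := exists_ball_subset_ball_inter hx hy hne
  set r := dist x y
  set S := ball c (r / 2)
  have hk : ∀ z ξ : E, ξ ∈ ball z (2 * r) → ENNReal.ofReal (dist (u z) (u ξ) ^ p) ≤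
      ENNReal.ofReal ((2 * r) ^ q) *
        ENNReal.ofReal (dist (u z) (u ξ) ^ p / ‖z - ξ‖ ^ q) := by
    intro z ξ hξ
    rcases eq_or_ne z ξ with rfl | hz
    · simp [Real.zero_rpow (show p ≠ 0 by linarith)]
    have h0 : 0 < ‖z - ξ‖ := norm_sub_pos_iff.2 hz
    rw [← ENNReal.ofReal_mul (by positivity)]
    apply ENNReal.ofReal_le_ofReal
    rw [← mul_div_assoc, le_div_iff₀ (by positivity), mul_comm]
    rw [mem_ball, dist_comm, dist_eq_norm] at hξ
    gcongr
  have hint : ∀ z, S ⊆ ball 0 R ∩ ball z (2 * r) →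
      ∫⁻ ξ in S, ENNReal.ofReal (dist (u z) (u ξ) ^ p) ∂μ ≤ ENNReal.ofReal ((2 * r) ^ q) *
        truncatedEnergy μ u (ball 0 R) p q z (2 * t) := by
    intro z hz
    rw [truncatedEnergy, ← lintegral_const_mul' _ _ ENNReal.ofReal_ne_top]
    refine (setLIntegral_mono' measurableSet_ball fun ξ hξ => hk z ξ (hz hξ).2).trans ?_
    refine lintegral_mono_set (hz.trans ?_)
    gcongr
  have hm : ∀ z, Measurable fun ξ => ENNReal.ofReal (dist (u z) (u ξ) ^ p) := fun z => by
    have : Measurable fun ξ => dist (u z) (u ξ) :=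
      (continuous_const.dist continuous_id).measurable.comp hu
    fun_prop
  have hmain : ENNReal.ofReal (dist (u x) (u y) ^ p) * μ S ≤
      2 ^ (p - 1) * (ENNReal.ofReal ((2 * r) ^ q) *
        (truncatedEnergy μ u (ball 0 R) p q x (2 * t) +
          truncatedEnergy μ u (ball 0 R) p q y (2 * t))) := by
    rw [← setLIntegral_const]
    refine (lintegral_mono fun ξ => ofReal_dist_rpow_le hp _ _ (u ξ)).trans ?_
    rw [lintegral_const_mul' _ _ (by simp), lintegral_add_left (hm x),
      mul_add (ENNReal.ofReal _)]
    gcongr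
    · exact hint x fun ξ hξ => (hc hξ).1
    · exact hint y fun ξ hξ => ⟨(hc hξ).1.1, (hc hξ).2⟩
  have hS : μ S = ENNReal.ofReal ((r / 2) ^ q) * μ (ball 0 1) := by
    rw [Measure.addHaar_ball_of_pos μ c (by positivity), hq, Real.rpow_natCast]
  have hV0 : μ (ball (0 : E) 1) ≠ 0 := (measure_ball_pos μ 0 one_pos).ne'
  have hV : μ (ball (0 : E) 1) ≠ ∞ := measure_ball_lt_top.ne
  have h4 : ENNReal.ofReal ((2 * r) ^ q) = ENNReal.ofReal (4 ^ q) * ENNReal.ofReal ((r / 2) ^ q) := by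
    rw [← ENNReal.ofReal_mul (by positivity), ← Real.mul_rpow (by norm_num) (by positivity)]
    ring_nf
  have hS0 : μ S ≠ 0 := (measure_ball_pos μ c (by positivity)).ne'
  have hST : μ S ≠ ∞ := measure_ball_lt_top.ne
  refine (ENNReal.mul_le_mul_iff_left hS0 hST).1 (hmain.trans_eq ?_)
  rw [h4, hS]
  calc _ = 2 ^ (p - 1) * ENNReal.ofReal (4 ^ q) * ENNReal.ofReal ((r / 2) ^ q) *
      (truncatedEnergy μ u (ball 0 R) p q x (2 * t) +
          truncatedEnergy μ u (ball 0 R) p q y (2 * t)) * 1 := by ring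
    _ = _ := by rw [← ENNReal.inv_mul_cancel hV0 hV]; ring

theorem lintegral_norm_rpow_inv_lt_top (μ : Measure E) [μ.IsAddHaarMeasure] {q : ℝ}
    (hq : Module.finrank ℝ E < q) :
    ∫⁻ h in {h : E | 1 < ‖h‖}, ENNReal.ofReal (‖h‖ ^ q)⁻¹ ∂μ < ∞ := by
  have hq0 : 0 ≤ q := (Nat.cast_nonneg _).trans hq.le
  have hfin := finite_integral_one_add_norm (μ := μ) hq
  refine lt_of_le_of_lt ?_ (ENNReal.mul_lt_top (ENNReal.ofReal_lt_top (r := 2 ^ q)) hfin)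
  rw [← lintegral_const_mul' _ _ ENNReal.ofReal_ne_top]
  refine (setLIntegral_mono' (measurableSet_lt measurable_const measurable_norm)
    fun h hh => ?_).trans (setLIntegral_le_lintegral _ _)
  have hh : 1 < ‖h‖ := hh
  rw [← ENNReal.ofReal_mul (by positivity), Real.rpow_neg (by positivity)]
  apply ENNReal.ofReal_le_ofReal
  rw [← div_eq_mul_inv, ← Real.div_rpow (by positivity) (by positivity),
    ← Real.inv_rpow (norm_nonneg h)]
  apply Real.rpow_le_rpow (by positivity) _ hq0
  rw [inv_le_iff_one_le_mul₀ (by positivity), div_mul_eq_mul_div, le_div_iff₀ (by positivity)]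
  linarith

theorem lintegral_norm_rpow_inv_eq (μ : Measure E) [μ.IsAddHaarMeasure] (σ : ℝ) {τ : ℝ}
    (hτ : 0 < τ) :
    ∫⁻ h in {h : E | τ < ‖h‖}, ENNReal.ofReal (‖h‖ ^ (Module.finrank ℝ E + σ))⁻¹ ∂μ =
      ENNReal.ofReal (τ ^ σ)⁻¹ *
        ∫⁻ h in {h : E | 1 < ‖h‖}, ENNReal.ofReal (‖h‖ ^ (Module.finrank ℝ E + σ))⁻¹ ∂μ := by
  have hms : ∀ c : ℝ, MeasurableSet {h : E | c < ‖h‖} := fun c =>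
    measurableSet_lt measurable_const measurable_norm
  have hmf : Measurable fun h : E => ENNReal.ofReal (‖h‖ ^ (Module.finrank ℝ E + σ))⁻¹ := by
    fun_prop
  have hd : 0 < τ ^ Module.finrank ℝ E := by positivity
  have hμ : μ = ENNReal.ofReal (τ ^ Module.finrank ℝ E) • Measure.map (τ • · : E → E) μ := by
    rw [Measure.map_addHaar_smul μ hτ.ne', smul_smul, ← ENNReal.ofReal_mul hd.le,
      abs_of_pos (inv_pos.2 hd), mul_inv_cancel₀ hd.ne', ENNReal.ofReal_one, one_smul]
  conv_lhs => rw [hμ]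
  rw [Measure.restrict_smul, lintegral_smul_measure,
    setLIntegral_map (hms τ) hmf (measurable_const_smul τ), smul_eq_mul,
    ← lintegral_const_mul' _ _ ENNReal.ofReal_ne_top,
    ← lintegral_const_mul' _ _ ENNReal.ofReal_ne_top]
  have hset : (τ • · : E → E) ⁻¹' {h : E | τ < ‖h‖} = {h | 1 < ‖h‖} := by
    ext h
    simp [norm_smul, abs_of_pos hτ, hτ]
  rw [hset]
  refine lintegral_congr fun h => ?_
  rw [← ENNReal.ofReal_mul hd.le, ← ENNReal.ofReal_mul (by positivity), norm_smul,
    Real.norm_of_nonneg hτ.le, Real.mul_rpow hτ.le (norm_nonneg h), Real.rpow_add hτ,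
    Real.rpow_natCast]
  congr 1
  field_simp

theorem lintegral_truncatedEnergy_le [PseudoMetricSpace N] [MeasurableSpace N]
    [BorelSpace N] (μ : Measure E) [μ.IsAddHaarMeasure] {u : E → N} (hu : Measurable u) (A : Set E)
    {p σ L : ℝ} (hp : 0 < p) (hσ : 0 < σ) (hL : 0 ≤ L) (x z : E) :
    ∫⁻ w, truncatedEnergy μ u A p (Module.finrank ℝ E) x (L * dist z w) *
        ENNReal.ofReal (‖z - w‖ ^ (Module.finrank ℝ E + σ))⁻¹ ∂μ ≤
      (∫⁻ h in {h : E | 1 < ‖h‖}, ENNReal.ofReal (‖h‖ ^ (Module.finrank ℝ E + σ))⁻¹ ∂μ) *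
        ENNReal.ofReal (L ^ σ) * ∫⁻ ξ in A,
          ENNReal.ofReal (dist (u x) (u ξ) ^ p / ‖x - ξ‖ ^ (Module.finrank ℝ E + σ)) ∂μ := by
  set d : ℝ := ((Module.finrank ℝ E : ℕ) : ℝ) with hd
  set C := ∫⁻ h in {h : E | 1 < ‖h‖}, ENNReal.ofReal (‖h‖ ^ (d + σ))⁻¹ ∂μ with hC
  have hCtop : C < ∞ := lintegral_norm_rpow_inv_lt_top μ (by simpa [d] using hσ)
  have hdist : Measurable fun ξ => dist (u x) (u ξ) :=
    (continuous_const.dist continuous_id).measurable.comp hu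
  let k : E → E → ℝ≥0∞ := fun w => (ball x (L * dist z w)).indicator fun ξ =>
    ENNReal.ofReal (dist (u x) (u ξ) ^ p / ‖x - ξ‖ ^ d) *
      ENNReal.ofReal (‖z - w‖ ^ (d + σ))⁻¹
  have hk : Measurable (Function.uncurry k) := by
    have : Function.uncurry k = {v : E × E | dist v.2 x < L * dist z v.1}.indicator fun v =>
        ENNReal.ofReal (dist (u x) (u v.2) ^ p / ‖x - v.2‖ ^ d) *
          ENNReal.ofReal (‖z - v.1‖ ^ (d + σ))⁻¹ := rfl
    rw [this]
    refine Measurable.indicator ?_ (measurableSet_lt (by fun_prop) (by fun_prop))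
    have : Measurable fun v : E × E => dist (u x) (u v.2) := hdist.comp measurable_snd
    fun_prop
  have hleft : ∀ w, truncatedEnergy μ u A p d x (L * dist z w) *
      ENNReal.ofReal (‖z - w‖ ^ (d + σ))⁻¹ = ∫⁻ ξ in A, k w ξ ∂μ := fun w => by
    rw [lintegral_indicator measurableSet_ball, Measure.restrict_restrict measurableSet_ball,
      lintegral_mul_const' _ _ ENNReal.ofReal_ne_top, Set.inter_comm, truncatedEnergy]
  simp_rw [hleft]
  rw [lintegral_lintegral_swap hk.aemeasurable,
    ← lintegral_const_mul' _ _ (ENNReal.mul_ne_top hCtop.ne ENNReal.ofReal_ne_top)]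
  refine lintegral_mono fun ξ => ?_
  rcases eq_or_ne x ξ with rfl | hne
  · simp [k, Set.indicator, Real.zero_rpow hp.ne']
  have hτ : 0 < ‖x - ξ‖ := norm_sub_pos_iff.2 hne
  rcases hL.eq_or_lt with rfl | hL
  · simp [k, Real.zero_rpow hσ.ne']
  have hset : ∀ w, ξ ∈ ball x (L * dist z w) ↔ z - w ∈ {h : E | ‖x - ξ‖ / L < ‖h‖} := fun w => by
    rw [mem_ball, dist_comm, dist_eq_norm, dist_eq_norm, Set.mem_ofPred_eq, div_lt_iff₀' hL]
  have hinner : ∫⁻ w, k w ξ ∂μ = ENNReal.ofReal (dist (u x) (u ξ) ^ p / ‖x - ξ‖ ^ d) *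
      (ENNReal.ofReal ((‖x - ξ‖ / L) ^ σ)⁻¹ * C) := by
    rw [hC, ← lintegral_norm_rpow_inv_eq μ σ (by positivity), ← hd,
      ← lintegral_const_mul' _ _ ENNReal.ofReal_ne_top,
      ← lintegral_indicator (measurableSet_lt measurable_const measurable_norm),
      ← lintegral_sub_left_eq_self _ z]
    refine lintegral_congr fun w => ?_
    simp only [k, Set.indicator, hset, _root_.sub_sub_cancel]
  rw [hinner, mul_comm C, mul_comm _ C, mul_left_comm, mul_comm (ENNReal.ofReal (L ^ σ)), mul_assoc C,
    mul_comm (ENNReal.ofReal (L ^ σ)), ← ENNReal.ofReal_mul (by positivity),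
    ← ENNReal.ofReal_mul (by positivity), Real.rpow_add hτ, Real.div_rpow hτ.le hL.le]
  apply le_of_eq
  congr 2
  field_simp

theorem exists_lintegral_comp_le (μ : Measure E) [μ.IsAddHaarMeasure] [Nontrivial E] {p σ : ℝ}
    (hp : 1 ≤ p) (hσ : 0 < σ) :
    ∃ C : ℝ≥0∞, C ≠ ∞ ∧ ∀ (N : Type) [MetricSpace N] [MeasurableSpace N] [BorelSpace N]
      (u : E → N) (Φ : E → E) (L : ℝ≥0) (R ρ : ℝ), Measurable u → LipschitzWith L Φ →
      Set.MapsTo Φ (ball 0 ρ) (ball 0 R) →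
      ∫⁻ x in ball 0 ρ, ∫⁻ y in ball 0 ρ, ENNReal.ofReal
        (dist (u (Φ x)) (u (Φ y)) ^ p / ‖x - y‖ ^ (Module.finrank ℝ E + σ)) ∂μ ∂μ ≤
      C * ENNReal.ofReal (L ^ σ) * ∫⁻ x in ball 0 ρ, ∫⁻ ξ in ball 0 R, ENNReal.ofReal
        (dist (u (Φ x)) (u ξ) ^ p / ‖Φ x - ξ‖ ^ (Module.finrank ℝ E + σ)) ∂μ ∂μ := by
  have hp0 : 0 < p := by linarith
  set d : ℝ := ((Module.finrank ℝ E : ℕ) : ℝ) with hd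
  have hd0 : 0 < d := Nat.cast_pos.2 Module.finrank_pos
  set C₀ := ∫⁻ h in {h : E | 1 < ‖h‖}, ENNReal.ofReal (‖h‖ ^ (d + σ))⁻¹ ∂μ with hC₀
  have hC₀top : C₀ ≠ ∞ := (lintegral_norm_rpow_inv_lt_top μ (by simpa [d] using hσ)).ne
  set C₁ : ℝ≥0∞ := 2 ^ (p - 1) * ENNReal.ofReal (4 ^ d) * (μ (ball (0 : E) 1))⁻¹ with hC₁
  have hC₁top : C₁ ≠ ∞ := by
    refine ENNReal.mul_ne_top (ENNReal.mul_ne_top ?_ ENNReal.ofReal_ne_top) ?_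
    · simp
    · exact ENNReal.inv_ne_top.2 (measure_ball_pos μ 0 one_pos).ne'
  refine ⟨2 * C₁ * (C₀ * ENNReal.ofReal (2 ^ σ)), ENNReal.mul_ne_top
    (ENNReal.mul_ne_top (by simp) hC₁top) (ENNReal.mul_ne_top hC₀top ENNReal.ofReal_ne_top), ?_⟩
  intro N _ _ _ u Φ L R ρ hu hΦ hmaps
  let g : E → E → ℝ≥0∞ := fun x y =>
    truncatedEnergy μ u (ball 0 R) p d (Φ x) (2 * (L * dist x y)) *
      ENNReal.ofReal (‖x - y‖ ^ (d + σ))⁻¹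
  have hg : Measurable (Function.uncurry g) := by
    have hΦm := hΦ.continuous.measurable
    have h := (measurable_truncatedEnergy μ hu (measurableSet_ball (x := (0 : E)) (ε := R))
      hp0 hd0).comp (f := fun z : E × E => (Φ z.1, 2 * (L * dist z.1 z.2))) (by fun_prop)
    exact h.mul (by fun_prop)
  have hgx : ∀ x, Measurable (g x) := fun x => hg.comp measurable_prodMk_left
  have hpt : ∀ x ∈ ball (0 : E) ρ, ∀ y ∈ ball (0 : E) ρ, ENNReal.ofReal
      (dist (u (Φ x)) (u (Φ y)) ^ p / ‖x - y‖ ^ (d + σ)) ≤ C₁ * (g x y + g y x) := by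
    intro x hx y hy
    have h := ofReal_dist_rpow_le_truncatedEnergy μ hu hp hd (hmaps hx) (hmaps hy)
      (hΦ.dist_le_mul x y)
    rw [div_eq_mul_inv, ENNReal.ofReal_mul (by positivity)]
    refine (mul_le_mul_left h _).trans_eq ?_
    simp only [g, dist_comm y x, norm_sub_rev y x]
    ring
  have hinner : ∀ x, ∫⁻ y in ball 0 ρ, g x y ∂μ ≤ C₀ * ENNReal.ofReal ((2 * L) ^ σ) *
      ∫⁻ ξ in ball 0 R, ENNReal.ofReal
        (dist (u (Φ x)) (u ξ) ^ p / ‖Φ x - ξ‖ ^ (d + σ)) ∂μ := by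
    intro x
    refine (setLIntegral_le_lintegral _ _).trans ?_
    simp only [g, ← mul_assoc (2 : ℝ)]
    exact lintegral_truncatedEnergy_le μ hu (ball 0 R) hp0 hσ (by positivity) (Φ x) x
  calc _ ≤ ∫⁻ x in ball 0 ρ, ∫⁻ y in ball 0 ρ, C₁ * (g x y + g y x) ∂μ ∂μ :=
        setLIntegral_mono' measurableSet_ball fun x hx =>
          setLIntegral_mono' measurableSet_ball fun y hy => hpt x hx y hy
    _ = C₁ * (∫⁻ x in ball 0 ρ, ∫⁻ y in ball 0 ρ, g x y ∂μ ∂μ +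
          ∫⁻ x in ball 0 ρ, ∫⁻ y in ball 0 ρ, g y x ∂μ ∂μ) := by
        have hgm : Measurable fun x => ∫⁻ y in ball 0 ρ, g x y ∂μ := hg.lintegral_prod_right'
        rw [← lintegral_add_left hgm, ← lintegral_const_mul' _ _ hC₁top]
        refine lintegral_congr fun x => ?_
        rw [lintegral_const_mul' _ _ hC₁top, lintegral_add_left (hgx x)]
    _ = 2 * C₁ * ∫⁻ x in ball 0 ρ, ∫⁻ y in ball 0 ρ, g x y ∂μ ∂μ := by
        rw [lintegral_lintegral_swap (f := fun x y => g y x)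
          (hg.comp measurable_swap).aemeasurable]
        ring
    _ ≤ 2 * C₁ * ∫⁻ x in ball 0 ρ, C₀ * ENNReal.ofReal ((2 * L) ^ σ) *
          ∫⁻ ξ in ball 0 R, ENNReal.ofReal
            (dist (u (Φ x)) (u ξ) ^ p / ‖Φ x - ξ‖ ^ (d + σ)) ∂μ ∂μ := by
        gcongr with x
        exact hinner x
    _ = _ := by
        rw [lintegral_const_mul' _ _ (ENNReal.mul_ne_top hC₀top ENNReal.ofReal_ne_top),
          Real.mul_rpow zero_le_two L.coe_nonneg, ENNReal.ofReal_mul (by positivity)]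
        ring

theorem lintegral_comp_translate_le (μ : Measure E) [μ.IsAddHaarMeasure] {e : E → ℝ≥0∞}
    (he : Measurable e) {φ : E → E} (hφ : Measurable φ) {r ρ R : ℝ}
    (hmaps : Set.MapsTo φ (ball 0 (ρ + r)) (ball 0 (R - r))) :
    ∫⁻ a in ball 0 r, ∫⁻ x in ball 0 ρ, e (φ (x - a) + a) ∂μ ∂μ ≤
      μ (ball 0 (ρ + r)) * ∫⁻ x in ball 0 R, e x ∂μ := by
  have htrans : ∀ a ∈ ball (0 : E) r, ∫⁻ x in ball 0 ρ, e (φ (x - a) + a) ∂μ ≤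
      ∫⁻ z in ball 0 (ρ + r), e (φ z + a) ∂μ := by
    intro a ha
    rw [← lintegral_indicator measurableSet_ball, ← lintegral_indicator measurableSet_ball,
      ← lintegral_sub_right_eq_self ((ball 0 (ρ + r)).indicator fun z => e (φ z + a)) a]
    refine lintegral_mono (Set.indicator_le fun x hx => ?_)
    have hxa : x - a ∈ ball (0 : E) (ρ + r) := by
      rw [mem_ball_zero_iff] at *
      linarith [norm_sub_le x a]
    rw [Set.indicator_of_mem hxa]
  calc _ ≤ ∫⁻ a in ball 0 r, ∫⁻ z in ball 0 (ρ + r), e (φ z + a) ∂μ ∂μ :=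
        setLIntegral_mono' measurableSet_ball htrans
    _ = ∫⁻ z in ball 0 (ρ + r), ∫⁻ a in ball 0 r, e (φ z + a) ∂μ ∂μ := by
        refine lintegral_lintegral_swap (Measurable.aemeasurable ?_)
        exact he.comp (by fun_prop)
    _ ≤ ∫⁻ z in ball 0 (ρ + r), ∫⁻ x in ball 0 R, e x ∂μ ∂μ := by
        refine setLIntegral_mono' measurableSet_ball fun z hz => ?_
        rw [← lintegral_indicator measurableSet_ball, ← lintegral_indicator measurableSet_ball,
          ← lintegral_add_left_eq_self ((ball 0 R).indicator e) (φ z)]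
        refine lintegral_mono (Set.indicator_le fun a ha => ?_)
        have hza : φ z + a ∈ ball (0 : E) R := by
          have := hmaps hz
          rw [mem_ball_zero_iff] at *
          linarith [norm_add_le (φ z) a]
        rw [Set.indicator_of_mem hza]
    _ = _ := by rw [setLIntegral_const, mul_comm]

end

/-- Opening of maps: for every Lipschitz change of variables `φ` there is a point `a`
such that the opened map `u ∘ (φ(· − a) + a)` has Gagliardo energy controlled linearly
by that of `u`. -/
theorem gagliardo_opening {m : ℕ} (hm : 1 ≤ m) (s p lam η : ℝ)
    (hs : s ∈ Set.Ioo (0 : ℝ) 1) (hp : 1 ≤ p) (hlam : 1 < lam)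
    (hη : η ∈ Set.Ioo (0 : ℝ) lam) :
    ∃ C : ℝ, 0 < C ∧
      ∀ (ρ : ℝ), 0 < ρ →
      ∀ (N : Type) [MetricSpace N] [MeasurableSpace N] [BorelSpace N],
      ∀ (u : EuclideanSpace ℝ (Fin m) → N), Measurable u →
      ∀ (φ : EuclideanSpace ℝ (Fin m) → EuclideanSpace ℝ (Fin m)) (L : ℝ≥0),
        LipschitzWith L φ →
        Set.MapsTo φ (ball 0 ((1 + η) * ρ)) (ball 0 ((lam - η) * ρ)) →
        ∃ a ∈ ball (0 : EuclideanSpace ℝ (Fin m)) (η * ρ),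
          gagliardoEnergy s p (fun x => u (φ (x - a) + a)) (ball 0 ρ)
            ≤ ENNReal.ofReal (C * (L : ℝ) ^ (s * p)) *
                gagliardoEnergy s p u (ball 0 (lam * ρ)) := by
  obtain ⟨hη0, hηlam⟩ := hη
  have : Nonempty (Fin m) := ⟨⟨0, hm⟩⟩
  have hp0 : 0 < p := by linarith
  have hσ : 0 < s * p := mul_pos hs.1 hp0
  obtain ⟨C, hC, hbound⟩ :=
    exists_lintegral_comp_le (volume : Measure (EuclideanSpace ℝ (Fin m))) hp hσ
  set K : ℝ≥0∞ := C * ENNReal.ofReal ((1 + η) / η) ^ m with hK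
  have hKtop : K ≠ ∞ := ENNReal.mul_ne_top hC (ENNReal.pow_ne_top ENNReal.ofReal_ne_top)
  refine ⟨K.toReal + 1, by positivity, ?_⟩
  intro ρ hρ N _ _ _ u hu φ L hφ hmaps
  set R := lam * ρ
  set r := η * ρ
  have hr : 0 < r := by positivity
  rw [show (1 + η) * ρ = ρ + r by ring, show (lam - η) * ρ = R - r by ring] at hmaps
  let e : EuclideanSpace ℝ (Fin m) → ℝ≥0∞ := fun x =>
    truncatedEnergy volume u (ball 0 R) p (m + s * p) x (2 * R)
  have hem : Measurable e :=
    (measurable_truncatedEnergy volume hu measurableSet_ball hp0 (by positivity)).comp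
      (f := fun x => (x, 2 * R)) (by fun_prop)
  have he : ∀ x ∈ ball (0 : EuclideanSpace ℝ (Fin m)) R, e x = ∫⁻ ξ in ball 0 R,
      ENNReal.ofReal (dist (u x) (u ξ) ^ p / ‖x - ξ‖ ^ ((m : ℝ) + s * p)) := by
    intro x hx
    have : ball (0 : EuclideanSpace ℝ (Fin m)) R ∩ ball x (2 * R) = ball 0 R := by
      refine Set.inter_eq_left.2 fun ξ hξ => ?_
      rw [mem_ball] at *
      linarith [dist_triangle_right ξ x 0]
    simp only [e, truncatedEnergy, this]
  have hE : ∫⁻ x in ball 0 R, e x = gagliardoEnergy s p u (ball 0 R) :=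
    setLIntegral_congr_fun measurableSet_ball he
  let M : EuclideanSpace ℝ (Fin m) → ℝ≥0∞ := fun a => ∫⁻ x in ball 0 ρ, e (φ (x - a) + a)
  have hM : Measurable M := by
    have hφm := hφ.continuous.measurable
    have : Measurable fun z : EuclideanSpace ℝ (Fin m) × EuclideanSpace ℝ (Fin m) =>
        e (φ (z.2 - z.1) + z.1) := hem.comp (by fun_prop)
    exact this.lintegral_prod_right'
  obtain ⟨a, ha, haM⟩ := exists_le_setLAverage (measure_ball_pos volume
    (0 : EuclideanSpace ℝ (Fin m)) hr).ne' measure_ball_lt_top.ne hM.aemeasurable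
  refine ⟨a, ha, ?_⟩
  have hMa : M a ≤ ENNReal.ofReal ((1 + η) / η) ^ m * gagliardoEnergy s p u (ball 0 R) := by
    refine haM.trans ?_
    rw [setLAverage_eq]
    refine ENNReal.div_le_of_le_mul
      ((lintegral_comp_translate_le volume hem hφ.continuous.measurable hmaps).trans_eq ?_)
    rw [hE, Measure.addHaar_ball_of_pos volume _ hr,
      Measure.addHaar_ball_of_pos volume _ (by positivity : 0 < ρ + r), finrank_euclideanSpace_fin,
      ← ENNReal.ofReal_pow (by positivity), show ρ + r = (1 + η) / η * r by simp only [r]; field_simp,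
      mul_pow, ENNReal.ofReal_mul (by positivity)]
    ring
  have hΦ : LipschitzWith L fun x => φ (x - a) + a := by
    refine LipschitzWith.of_dist_le_mul fun x y => ?_
    simpa using hφ.dist_le_mul (x - a) (y - a)
  have hΦmaps : Set.MapsTo (fun x => φ (x - a) + a) (ball 0 ρ) (ball 0 R) := by
    intro x hx
    have hxa : x - a ∈ ball (0 : EuclideanSpace ℝ (Fin m)) (ρ + r) := by
      rw [mem_ball_zero_iff] at *
      linarith [norm_sub_le x a]
    have := hmaps hxa
    rw [mem_ball_zero_iff] at *
    linarith [norm_add_le (φ (x - a)) a]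
  have hfin := hbound N u _ L R ρ hu hΦ hΦmaps
  rw [finrank_euclideanSpace_fin] at hfin
  refine hfin.trans ?_
  rw [← setLIntegral_congr_fun measurableSet_ball fun x hx => he _ (hΦmaps hx)]
  calc C * ENNReal.ofReal (L ^ (s * p)) * M a
      ≤ C * ENNReal.ofReal (L ^ (s * p)) *
        (ENNReal.ofReal ((1 + η) / η) ^ m * gagliardoEnergy s p u (ball 0 R)) := by gcongr
    _ = ENNReal.ofReal (K.toReal * L ^ (s * p)) * gagliardoEnergy s p u (ball 0 R) := by
        rw [ENNReal.ofReal_mul (by positivity), ENNReal.ofReal_toReal hKtop, hK]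
        ring
    _ ≤ _ := by
        gcongr
        linarith
end
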